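/- arXiv:math/0411042 — 3 statements merged into one kernel-verified Lean document; each statement's English description precedes it below -/
import Mathlib

section
/- Let p, q_1, q_2, r be real polynomials satisfying: (H1) p(x) > 0 for all x, q_1(0) < 0, and x·r(x) > 0 for all x ≠ 0; (H2) q_1 has even degree and positive leading coefficient; (H3) deg p ≥ deg q_2 + 2; (H4) if q_2 has odd degree then its leading coefficient is negative; (H5) deg r ≤ 2·deg q_1 + deg q_2 + 1. Then the planar system u' = v, v' = -q_1(u) v - (q_2(u)/p(u)) v² - r(u)/p(u), equivalent to the second-order equation p(x) x'' + p(x) q_1(x) x' + q_2(x) (x')² + r(x) = 0, has at least one nonconstant periodic solution. -/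
open Set Filter Topology

/-- A bounded, globally Lipschitz vector field has a globally defined, jointly continuous flow. -/
theorem exists_global_flow {E : Type*} [NormedAddCommGroup E] [NormedSpace ℝ E] [CompleteSpace E]
    {X : E → E} {K C : NNReal} (hL : LipschitzWith K X) (hC : ∀ x, ‖X x‖ ≤ C) :
    ∃ φ : E → ℝ → E, (∀ x, φ x 0 = x) ∧ (∀ x t, HasDerivAt (φ x) (X (φ x t)) t) ∧
      Continuous fun p : E × ℝ => φ p.1 p.2 := by
  have key : ∀ n : ℕ, ∃ α : E × ℝ → E, (∀ x ∈ Metric.closedBall (0 : E) n, α ⟨x, 0⟩ = x ∧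
      ∀ t ∈ Ioo (-n : ℝ) n, HasDerivAt (α ⟨x, ·⟩) (X (α ⟨x, t⟩)) t) ∧
      ContinuousOn α (Metric.closedBall (0 : E) n ×ˢ Icc (-n : ℝ) n) := by
    intro n
    have hn : (0 : ℝ) ≤ n := Nat.cast_nonneg n
    have h := IsPicardLindelof.of_time_independent (f := X) (tmin := -n) (tmax := n)
      (t₀ := ⟨0, by simp, hn⟩) (x₀ := 0) (a := n + C * n) (r := n) (L := C) (K := K)
      (fun x _ => hC x) hL.lipschitzOnWith (by simp)
    obtain ⟨α, h1, h2⟩ := h.exists_forall_mem_closedBall_eq_hasDerivWithinAt_continuousOn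
    refine ⟨α, fun x hx => ⟨(h1 x (by simpa using hx)).1, fun t ht => ?_⟩, by simpa using h2⟩
    exact ((h1 x (by simpa using hx)).2 t (Ioo_subset_Icc_self ht)).hasDerivAt
      (Icc_mem_nhds ht.1 ht.2)
  choose α h1 h2 using key
  have agree_le : ∀ m n : ℕ, m ≤ n → ∀ x : E, ‖x‖ ≤ m → ∀ t ∈ Ioo (-m : ℝ) m,
      α m (x, t) = α n (x, t) := by
    intro m n hmn x hx t ht
    have hmn' : (m : ℝ) ≤ n := by exact_mod_cast hmn
    have h0 : (0 : ℝ) ∈ Ioo (-m : ℝ) m := by constructor <;> linarith [ht.1, ht.2]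
    have hm := h1 m x (by simpa using hx)
    have hn := h1 n x (by simpa using hx.trans hmn')
    exact ODE_solution_unique_of_mem_Ioo (v := fun _ => X) (s := fun _ => univ) (K := K)
      (fun _ _ => hL.lipschitzOnWith) h0 (fun s hs => ⟨hm.2 s hs, trivial⟩)
      (fun s hs => ⟨hn.2 s ⟨by linarith [hs.1], by linarith [hs.2]⟩, trivial⟩)
      (hm.1.trans hn.1.symm) ht
  let φ : E → ℝ → E := fun x t => α (⌈max ‖x‖ |t|⌉₊ + 1) (x, t)
  have hφ : ∀ (n : ℕ) (x : E) (t : ℝ), ‖x‖ < n → |t| < n → φ x t = α n (x, t) := by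
    intro n x t hx ht
    set m := ⌈max ‖x‖ |t|⌉₊ + 1 with hm
    have hm' : max ‖x‖ |t| < m := by
      rw [hm]; push_cast; linarith [Nat.le_ceil (max ‖x‖ |t|)]
    have hxm : ‖x‖ < m := (le_max_left _ _).trans_lt hm'
    have htm : |t| < m := (le_max_right _ _).trans_lt hm'
    rcases le_total m n with h | h
    · exact agree_le m n h x hxm.le t (abs_lt.mp htm)
    · exact (agree_le n m h x hx.le t (abs_lt.mp ht)).symm
  refine ⟨φ, fun x => ?_, fun x t => ?_, continuous_iff_continuousAt.mpr ?_⟩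
  · obtain ⟨n, hn⟩ := exists_nat_gt ‖x‖
    rw [hφ n x 0 hn (by simpa using (norm_nonneg x).trans_lt hn)]
    exact (h1 n x (by simpa using hn.le)).1
  · obtain ⟨n, hn⟩ := exists_nat_gt (max ‖x‖ |t|)
    have hx := (le_max_left _ _).trans_lt hn
    have ht := (le_max_right _ _).trans_lt hn
    rw [hφ n x t hx ht]
    refine ((h1 n x (by simpa using hx.le)).2 t (abs_lt.mp ht)).congr_of_eventuallyEq ?_
    filter_upwards [continuous_abs.continuousAt.eventually_lt_const ht] with s hs
    exact hφ n x s hx hs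
  · rintro ⟨x, t⟩
    obtain ⟨n, hn⟩ := exists_nat_gt (max ‖x‖ |t|)
    have hx := (le_max_left _ _).trans_lt hn
    have ht := (le_max_right _ _).trans_lt hn
    have e1 : ∀ᶠ p : E × ℝ in 𝓝 (x, t), ‖p.1‖ < n :=
      (continuous_fst.norm.continuousAt (x := (x, t))).eventually_lt_const hx
    have e2 : ∀ᶠ p : E × ℝ in 𝓝 (x, t), |p.2| < n :=
      (continuous_snd.abs.continuousAt (x := (x, t))).eventually_lt_const ht
    refine ContinuousAt.congr ((h2 n).continuousAt ?_) (f := α n) ?_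
    · filter_upwards [e1, e2] with p hp1 hp2
      exact ⟨by simpa using hp1.le, Ioo_subset_Icc_self (abs_lt.mp hp2)⟩
    · filter_upwards [e1, e2] with p hp1 hp2
      exact (hφ n p.1 p.2 hp1 hp2).symm

theorem le_of_deriv_nonpos_above {h h' : ℝ → ℝ} {a b c : ℝ}
    (hd : ∀ t ∈ Icc a b, HasDerivAt h (h' t) t) (ha : h a ≤ c)
    (hn : ∀ t ∈ Icc a b, c ≤ h t → h' t ≤ 0) : ∀ t ∈ Icc a b, h t ≤ c := by
  intro t ht
  by_contra! hlt
  have hc : ContinuousOn h (Icc a b) := fun s hs => (hd s hs).continuousAt.continuousWithinAt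
  let A := Icc a t ∩ h ⁻¹' Iic c
  have hsub : Icc a t ⊆ Icc a b := Icc_subset_Icc_right ht.2
  have hA : IsCompact A :=
    isCompact_Icc.of_isClosed_subset
      ((hc.mono hsub).preimage_isClosed_of_isClosed isClosed_Icc isClosed_Iic) inter_subset_left
  obtain ⟨s, hs, hmax⟩ := hA.exists_isGreatest ⟨a, ⟨le_rfl, ht.1⟩, ha⟩
  have hst : Icc s t ⊆ Icc a b := (Icc_subset_Icc_left hs.1.1).trans hsub
  have hanti : AntitoneOn h (Icc s t) := by
    refine antitoneOn_of_hasDerivWithinAt_nonpos (f' := h') (convex_Icc s t) (hc.mono hst) ?_ ?_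
    · intro x hx
      exact (hd x (hst (interior_subset hx))).hasDerivWithinAt
    · intro x hx
      rw [interior_Icc] at hx
      refine hn x (hst (Ioo_subset_Icc_self hx)) (le_of_not_ge fun hxc => ?_)
      exact absurd (hmax ⟨⟨hs.1.1.trans hx.1.le, hx.2.le⟩, hxc⟩) (not_le.mpr hx.1)
  have := hanti ⟨le_rfl, hs.1.2⟩ ⟨hs.1.2, le_rfl⟩ hs.1.2
  have h2 : h s ≤ c := hs.2
  linarith

/-- Forward invariance of a set cut out by finitely or infinitely many barrier functions. -/
theorem forward_invariant_of_barriers {ι E : Type*} [TopologicalSpace E] {γ : ℝ → E}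
    (hγ : Continuous γ) {h : ι → E → ℝ} {c : ι → ℝ} {d : ι → ℝ → ℝ} {N : Set E} (hN : IsOpen N)
    (hcont : ∀ i, Continuous (h i)) (hsub : {z | ∀ i, h i z ≤ c i} ⊆ N)
    (hd : ∀ i t, γ t ∈ N → HasDerivAt (fun s => h i (γ s)) (d i t) t)
    (hn : ∀ i t, γ t ∈ N → c i ≤ h i (γ t) → d i t ≤ 0)
    (h0 : ∀ i, h i (γ 0) ≤ c i) : ∀ t, 0 ≤ t → ∀ i, h i (γ t) ≤ c i := by
  intro t ht
  let S : Set E := {z | ∀ i, h i z ≤ c i}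
  have hS : IsClosed S := by
    simp only [S, Set.ofPred_forall]
    exact isClosed_iInter fun i => isClosed_le (hcont i) continuous_const
  have hcl : IsClosed (γ ⁻¹' S ∩ Icc 0 t) := (hS.preimage hγ).inter isClosed_Icc
  refine (hcl.Icc_subset_of_forall_exists_gt h0 ?_) ⟨ht, le_rfl⟩
  rintro x ⟨hx, hx0⟩ y hy
  obtain ⟨l, u, hlu, hN'⟩ := mem_nhds_iff_exists_Ioo_subset.mp
    ((hN.preimage hγ).mem_nhds (hsub hx))
  obtain ⟨z, hz1, hz2⟩ := exists_between (lt_min hlu.2 hy : x < min u y)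
  have hzN : ∀ s ∈ Icc x z, γ s ∈ N := fun s hs =>
    hN' ⟨hlu.1.trans_le hs.1, hs.2.trans_lt (hz2.trans_le (min_le_left _ _))⟩
  refine ⟨z, fun i => ?_, hz1, (hz2.trans_le (min_le_right _ _)).le⟩
  exact le_of_deriv_nonpos_above (fun s hs => hd i s (hzN s hs)) (hx i)
    (fun s hs => hn i s (hzN s hs)) z ⟨hz1.le, le_rfl⟩

/-- Continuity of the first return time to a transversal section. -/
theorem exists_continuous_hitting_time {I : Type*} [TopologicalSpace I] {x y : I → ℝ → ℝ}
    (hx : Continuous fun p : I × ℝ => x p.1 p.2) (hy : Continuous fun p : I × ℝ => y p.1 p.2)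
    (hd : ∀ i t, HasDerivAt (x i) (y i t) t) (h0 : ∀ i, x i 0 = 0) (hy0 : ∀ i, 0 < y i 0)
    (hex : ∀ i, ∃ t, 0 < t ∧ x i t ≤ 0) (htr : ∀ i t, 0 < t → x i t = 0 → y i t ≠ 0) :
    ∃ τ : I → ℝ, Continuous τ ∧ ∀ i, 0 < τ i ∧ x i (τ i) = 0 ∧ y i (τ i) < 0 := by
  have hxi : ∀ i, Continuous (x i) := fun i => hx.comp (by fun_prop : Continuous fun t => (i, t))
  have start : ∀ i, ∃ δ > 0, ∀ᶠ j in 𝓝 i, ∀ t, 0 < t → t < δ → 0 < x j t := by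
    intro i
    have hpos : ∀ᶠ p : I × ℝ in 𝓝 i ×ˢ 𝓝 0, 0 < y p.1 p.2 := by
      rw [← nhds_prod_eq]
      exact (hy.continuousAt (x := (i, (0 : ℝ)))).eventually_const_lt (hy0 i)
    obtain ⟨P, hP, Q, hQ, hPQ⟩ := eventually_prod_iff.mp hpos
    obtain ⟨δ, hδ, hball⟩ := Metric.eventually_nhds_iff.mp hQ
    refine ⟨δ, hδ, hP.mono fun j hj t ht htδ => ?_⟩
    have hmono : StrictMonoOn (x j) (Icc 0 t) := by
      refine strictMonoOn_of_deriv_pos (convex_Icc 0 t) (hxi j).continuousOn fun s hs => ?_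
      rw [interior_Icc] at hs
      rw [(hd j s).deriv]
      refine hPQ hj (hball ?_)
      rw [Real.dist_0_eq_abs, abs_of_pos hs.1]
      exact hs.2.trans htδ
    simpa [h0 j] using hmono ⟨le_rfl, ht.le⟩ ⟨ht.le, le_rfl⟩ ht
  have first : ∀ i, ∃ τ, 0 < τ ∧ x i τ ≤ 0 ∧ ∀ t, 0 < t → t < τ → 0 < x i t := by
    intro i
    obtain ⟨δ, hδ, hev⟩ := start i
    have hi := hev.self_of_nhds
    obtain ⟨t₁, ht₁, hxt₁⟩ := hex i
    have hδt : δ ≤ t₁ := le_of_not_gt fun h => absurd (hi t₁ ht₁ h) (not_lt.mpr hxt₁)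
    have hA : IsCompact (Icc δ t₁ ∩ x i ⁻¹' Iic 0) :=
      isCompact_Icc.inter_right (isClosed_Iic.preimage (hxi i))
    obtain ⟨τ, hτ, hmin⟩ := hA.exists_isLeast ⟨t₁, ⟨hδt, le_rfl⟩, hxt₁⟩
    refine ⟨τ, hδ.trans_le hτ.1.1, hτ.2, fun t ht htτ => ?_⟩
    rcases lt_or_ge t δ with h | h
    · exact hi t ht h
    · by_contra! hle
      exact absurd (hmin ⟨⟨h, htτ.le.trans hτ.1.2⟩, hle⟩) (not_le.mpr htτ)
  choose τ hτ0 hτx hτpos using first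
  have hzero : ∀ i, x i (τ i) = 0 := by
    intro i
    refine le_antisymm (hτx i) ?_
    have hmem : τ i ∈ closure (Ioo 0 (τ i)) := by
      rw [closure_Ioo (hτ0 i).ne]
      exact ⟨(hτ0 i).le, le_rfl⟩
    exact closure_minimal (fun t ht => (hτpos i t ht.1 ht.2).le)
      (isClosed_Ici.preimage (hxi i)) hmem
  have hneg : ∀ i, y i (τ i) < 0 := by
    intro i
    refine lt_of_le_of_ne (le_of_not_gt fun hpos => ?_) (htr i _ (hτ0 i) (hzero i))
    have hev : ∀ᶠ t in 𝓝[<] τ i, x i t < 0 := by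
      have := (hasDerivWithinAt_iff_tendsto_slope' self_notMem_Iio).mp
        ((hd i (τ i)).hasDerivWithinAt (s := Iio (τ i)))
      filter_upwards [this.eventually_const_lt hpos, self_mem_nhdsWithin] with t ht htlt
      rw [slope_def_field, hzero i, sub_zero] at ht
      have hlt : t - τ i < 0 := sub_neg.mpr htlt
      by_contra! hge
      exact absurd ht (not_lt.mpr (div_nonpos_of_nonneg_of_nonpos (by linarith) hlt.le))
    obtain ⟨t, ht, ht'⟩ := (hev.and (Ioo_mem_nhdsLT (hτ0 i))).exists
    exact absurd (hτpos i t ht'.1 ht'.2) ht.not_gt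
  refine ⟨τ, continuous_iff_continuousAt.mpr fun i => ?_, fun i => ⟨hτ0 i, hzero i, hneg i⟩⟩
  refine tendsto_order.mpr ⟨fun s hs => ?_, fun s hs => ?_⟩
  · obtain ⟨δ, hδ, hev⟩ := start i
    have hK : ∀ᶠ j in 𝓝 i, ∀ t ∈ Icc δ s, 0 < x j t := by
      refine isCompact_Icc.eventually_forall_of_forall_eventually fun t ht => ?_
      exact (hx.continuousAt (x := (i, t))).eventually_const_lt
        (hτpos i t (hδ.trans_le ht.1) (ht.2.trans_lt hs))
    filter_upwards [hev, hK] with j hj1 hj2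
    by_contra! hle
    rcases lt_or_ge (τ j) δ with h | h
    · exact (hj1 _ (hτ0 j) h).ne' (hzero j)
    · exact (hj2 _ ⟨h, hle⟩).ne' (hzero j)
  · have hev : ∀ᶠ t in 𝓝[>] τ i, x i t < 0 := by
      have := (hasDerivWithinAt_iff_tendsto_slope' self_notMem_Ioi).mp
        ((hd i (τ i)).hasDerivWithinAt (s := Ioi (τ i)))
      filter_upwards [this.eventually_lt_const (hneg i), self_mem_nhdsWithin] with t ht htlt
      rw [slope_def_field, hzero i, sub_zero] at ht
      have hlt : 0 < t - τ i := sub_pos.mpr htlt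
      by_contra! hge
      exact absurd ht (not_lt.mpr (div_nonneg hge hlt.le))
    obtain ⟨t, ht, ht'⟩ := (hev.and (Ioo_mem_nhdsGT hs)).exists
    have : ∀ᶠ j in 𝓝 i, x j t < 0 :=
      ((hx.comp (by fun_prop : Continuous fun j => (j, t))).continuousAt (x := i)).eventually_lt_const
        ht
    filter_upwards [this] with j hj
    by_contra! hle
    exact absurd (hτpos j t ((hτ0 i).trans ht'.1) (ht'.2.trans_le hle)) hj.not_gt

theorem abs_le_of_deriv_le_arctan {k κ : ℝ → ℝ} {C : ℝ} (hd : ∀ u, HasDerivAt k (κ u) u)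
    (h0 : k 0 = 0) (hκ : ∀ u, |κ u| ≤ C / (1 + u ^ 2)) (u : ℝ) : |k u| ≤ C * 2 := by
  have hC : 0 ≤ C := by simpa using (abs_nonneg _).trans (hκ 0)
  have hat : ∀ u, HasDerivAt (fun u => C * Real.arctan u) (C / (1 + u ^ 2)) u := fun u => by
    simpa [div_eq_mul_inv] using (Real.hasDerivAt_arctan u).const_mul C
  have m1 : Monotone fun u => C * Real.arctan u - k u :=
    monotone_of_hasDerivAt_nonneg (fun u => (hat u).sub (hd u))
      (fun u => sub_nonneg.mpr ((le_abs_self _).trans (hκ u)))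
  have m2 : Monotone fun u => C * Real.arctan u + k u :=
    monotone_of_hasDerivAt_nonneg (fun u => (hat u).add (hd u))
      (fun u => by have := (neg_le_abs _).trans (hκ u); simp only [Pi.zero_apply]; linarith)
  have hu := Real.arctan_lt_pi_div_two u
  have hl := Real.neg_pi_div_two_lt_arctan u
  have hpi := Real.pi_le_four
  have b1 : C * Real.arctan u ≤ C * 2 := mul_le_mul_of_nonneg_left (by linarith) hC
  have b2 : C * (-2) ≤ C * Real.arctan u := mul_le_mul_of_nonneg_left (by linarith) hC
  rw [abs_le]
  rcases le_total 0 u with h | h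
  · have h1 := m1 h
    have h2 := m2 h
    simp only [Real.arctan_zero, mul_zero, h0] at h1 h2
    constructor <;> linarith
  · have h1 := m1 h
    have h2 := m2 h
    simp only [Real.arctan_zero, mul_zero, h0] at h1 h2
    constructor <;> linarith

theorem Continuous.exists_antideriv {f : ℝ → ℝ} (hf : Continuous f) :
    ∃ F : ℝ → ℝ, F 0 = 0 ∧ ∀ u, HasDerivAt F (f u) u :=
  ⟨fun u => ∫ s in (0 : ℝ)..u, f s, by simp, fun u => hf.integral_hasStrictDerivAt 0 u |>.hasDerivAt⟩

theorem exists_clamp {M₀ M : ℝ} (h0 : 0 ≤ M₀) (hM : M₀ < M) :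
    ∃ (k κ : ℝ → ℝ) (κ₀ : ℝ), k 0 = 0 ∧ Continuous κ ∧ (∀ u, HasDerivAt k (κ u) u) ∧
      (∀ u, |k u| ≤ 2) ∧ (∀ u, 0 ≤ κ u) ∧ (∀ u, M ≤ |u| → κ u = 0) ∧ 0 < κ₀ ∧
      ∀ u, |u| ≤ M₀ → κ₀ ≤ κ u := by
  let κ : ℝ → ℝ := fun u => max 0 (1 / (1 + u ^ 2) - 1 / (1 + M ^ 2))
  have hκ : Continuous κ := by
    refine continuous_const.max (Continuous.sub (Continuous.div₀ ?_ ?_ fun u => ?_) ?_)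
    any_goals fun_prop
    positivity
  obtain ⟨k, hk0, hk⟩ := hκ.exists_antideriv
  have hpos : ∀ u, 0 ≤ κ u := fun u => le_max_left _ _
  refine ⟨k, κ, 1 / (1 + M₀ ^ 2) - 1 / (1 + M ^ 2), hk0, hκ, hk, fun u => ?_, hpos,
    fun u hu => ?_, ?_, fun u hu => le_max_of_le_right ?_⟩
  · refine (abs_le_of_deriv_le_arctan (C := 1) hk hk0 (fun u => ?_) u).trans_eq (one_mul 2)
    rw [abs_of_nonneg (hpos u)]
    refine max_le (by positivity) (sub_le_self _ (by positivity))
  · refine max_eq_left (sub_nonpos.mpr (one_div_le_one_div_of_le (by positivity) ?_))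
    have : M ^ 2 ≤ u ^ 2 := by
      rw [← sq_abs u]; exact pow_le_pow_left₀ (by linarith) hu 2
    linarith
  · refine sub_pos.mpr (one_div_lt_one_div_of_lt (by positivity) ?_)
    nlinarith
  · refine sub_le_sub_right (one_div_le_one_div_of_le (by positivity) ?_) _
    have : u ^ 2 ≤ M₀ ^ 2 := by
      rw [← sq_abs u]; exact pow_le_pow_left₀ (abs_nonneg u) hu 2
    linarith

/-- A modified energy `(w - k u) ^ 2 / 2 + G u` that decreases along the Liénard flow
outside of one of its sublevel sets. -/
theorem exists_energy_nonincreasing_above {F a g G : ℝ → ℝ} (hF : Continuous F) (ha : Continuous a)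
    (hg : Continuous g) (hG : Continuous G) (hapos : ∀ u, 0 < a u) (hgu : ∀ u, u ≠ 0 → 0 < u * g u)
    (hFtop : Tendsto F atTop atTop) (hFbot : Tendsto F atBot atBot) (e : ℝ) :
    ∃ (k κ : ℝ → ℝ) (c : ℝ), k 0 = 0 ∧ (∀ u, HasDerivAt k (κ u) u) ∧ (∀ u, |k u| ≤ 2) ∧ e ≤ c ∧
      ∀ u w, c ≤ (w - k u) ^ 2 / 2 + G u →
        g u * (k u - F u) - κ u * a u * ((w - k u) * (w - F u)) ≤ 0 := by
  obtain ⟨p, hp⟩ := (hFtop.eventually_ge_atTop 2).exists_forall_of_atTop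
  obtain ⟨n, hn⟩ := (hFbot.eventually_le_atBot (-2)).exists_forall_of_atBot
  set M₀ := max |p| |n| with hM₀
  have hM₀0 : 0 ≤ M₀ := (abs_nonneg _).trans (le_max_left _ _)
  obtain ⟨k, κ, κ₀, hk0, hκ, hk, hk2, hκ0, hκM, hκ₀, hκ₀le⟩ := exists_clamp hM₀0 (lt_add_one M₀)
  have hkc : Continuous k := continuous_iff_continuousAt.mpr fun u => (hk u).continuousAt
  have hgk : ∀ u, M₀ ≤ |u| → g u * (k u - F u) ≤ 0 := by
    intro u hu
    have hk' := abs_le.mp (hk2 u)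
    rcases lt_trichotomy u 0 with h | h | h
    · have hgneg : g u < 0 := by have := hgu u h.ne; nlinarith
      have : u ≤ n := by
        rw [abs_of_neg h] at hu
        have := (le_max_right |p| |n|).trans hu
        have := neg_abs_le n
        linarith
      exact mul_nonpos_of_nonpos_of_nonneg hgneg.le (by linarith [hn u this])
    · subst h
      have hp0 : |p| ≤ 0 := (le_max_left _ _).trans (by rwa [abs_zero] at hu)
      have hn0 : |n| ≤ 0 := (le_max_right _ _).trans (by rwa [abs_zero] at hu)
      have hp' : p = 0 := abs_nonpos_iff.mp hp0
      have hn' : n = 0 := abs_nonpos_iff.mp hn0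
      have := hp 0 hp'.le
      have := hn 0 hn'.ge
      linarith
    · have hgpos : 0 < g u := by have := hgu u h.ne'; nlinarith
      have : p ≤ u := by
        rw [abs_of_pos h] at hu
        exact (le_abs_self p).trans ((le_max_left |p| |n|).trans hu)
      exact mul_nonpos_of_nonneg_of_nonpos hgpos.le (by linarith [hp u this])
  have hB : IsCompact (Icc (-(M₀ + 1)) (M₀ + 1)) := isCompact_Icc
  obtain ⟨A, hA⟩ := hB.exists_bound_of_continuousOn (f := F) hF.continuousOn
  obtain ⟨D, hD⟩ := hB.exists_bound_of_continuousOn (f := fun u => g u * (k u - F u))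
    (by fun_prop)
  obtain ⟨u₁, -, hu₁⟩ := hB.exists_isMinOn (f := a) ⟨0, by constructor <;> linarith⟩ ha.continuousOn
  have ha₁ := hapos u₁
  have hm : 0 < κ₀ * a u₁ := mul_pos hκ₀ ha₁
  have hA0 : 0 ≤ A := (norm_nonneg _).trans (hA 0 (by constructor <;> linarith))
  have hD0 : 0 ≤ D := (norm_nonneg _).trans (hD 0 (by constructor <;> linarith))
  set s := D / (κ₀ * a u₁) + 1 with hs
  have hs1 : 1 ≤ s := by rw [hs]; linarith [div_nonneg hD0 hm.le]
  have hDs : D ≤ κ₀ * a u₁ * s := by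
    rw [hs, mul_add, mul_div_cancel₀ _ hm.ne']; linarith
  set W := A + 2 + s with hW
  obtain ⟨c, hc⟩ := (hB.prod (isCompact_Icc (a := -W) (b := W))).exists_bound_of_continuousOn
    (f := fun z : ℝ × ℝ => (z.2 - k z.1) ^ 2 / 2 + G z.1) (by fun_prop)
  refine ⟨k, κ, max e (c + 1), hk0, hk, hk2, le_max_left _ _, fun u w hcw => ?_⟩
  have hcw' := (le_max_right _ _).trans hcw
  rcases lt_or_ge (M₀ + 1) |u| with hu | hu
  · rw [hκM u hu.le]
    simpa using hgk u (by linarith)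
  have huI : u ∈ Icc (-(M₀ + 1)) (M₀ + 1) := abs_le.mp hu
  have hw : W < |w| := by
    by_contra! hw
    have := (le_abs_self _).trans (hc (u, w) ⟨huI, abs_le.mp hw⟩)
    simp only at this
    linarith
  have hFA := abs_le.mp (hA u huI)
  have hk' := abs_le.mp (hk2 u)
  have hprod : s ≤ (w - k u) * (w - F u) := by
    rcases lt_abs.mp hw with h | h
    · have h1 : s ≤ w - k u := by linarith
      have h2 : s ≤ w - F u := by linarith
      nlinarith
    · have h1 : s ≤ -(w - k u) := by linarith
      have h2 : s ≤ -(w - F u) := by linarith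
      nlinarith
  rcases le_or_gt |u| M₀ with hu' | hu'
  · have h1 : κ₀ * a u₁ ≤ κ u * a u :=
      mul_le_mul (hκ₀le u hu') (hu₁ huI) ha₁.le (hκ0 u)
    have h2 : κ₀ * a u₁ * s ≤ κ u * a u * ((w - k u) * (w - F u)) :=
      mul_le_mul h1 hprod (by linarith) (hm.le.trans h1)
    linarith [(le_abs_self _).trans (hD u huI)]
  · have := mul_nonneg (mul_nonneg (hκ0 u) (hapos u).le) ((zero_le_one.trans hs1).trans hprod)
    linarith [hgk u hu'.le]

theorem hasDerivAt_fst_of_prod {γ : ℝ → ℝ × ℝ} {v : ℝ × ℝ} {t : ℝ} (h : HasDerivAt γ v t) :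
    HasDerivAt (fun s => (γ s).1) v.1 t :=
  (hasFDerivAt_fst (𝕜 := ℝ) (p := γ t)).comp_hasDerivAt t h

theorem hasDerivAt_snd_of_prod {γ : ℝ → ℝ × ℝ} {v : ℝ × ℝ} {t : ℝ} (h : HasDerivAt γ v t) :
    HasDerivAt (fun s => (γ s).2) v.2 t :=
  (hasFDerivAt_snd (𝕜 := ℝ) (p := γ t)).comp_hasDerivAt t h

theorem flow_add {E : Type*} [NormedAddCommGroup E] [NormedSpace ℝ E] {X : E → E} {K : NNReal}
    (hL : LipschitzWith K X) {φ : E → ℝ → E} (h0 : ∀ x, φ x 0 = x)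
    (hφ : ∀ x t, HasDerivAt (φ x) (X (φ x t)) t) (x : E) (s t : ℝ) :
    φ x (s + t) = φ (φ x s) t := by
  refine congrFun (ODE_solution_unique_univ (v := fun _ => X) (s := fun _ => univ) (K := K)
    (f := fun t => φ x (s + t)) (t₀ := 0) (fun _ => hL.lipschitzOnWith)
    (fun t => ⟨(hφ x (s + t)).comp_const_add s t, trivial⟩) (fun t => ⟨hφ _ t, trivial⟩) ?_) t
  simp [h0]

/-- The half return map of a planar flow in an annular region around the origin. -/
theorem exists_half_return_map {X : ℝ × ℝ → ℝ × ℝ} (hX : Continuous X) {φ : ℝ × ℝ → ℝ → ℝ × ℝ}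
    (hφ0 : ∀ x, φ x 0 = x) (hφ : ∀ x t, HasDerivAt (φ x) (X (φ x t)) t)
    (hφc : Continuous fun p : (ℝ × ℝ) × ℝ => φ p.1 p.2) {S : Set (ℝ × ℝ)}
    (hinv : ∀ z ∈ S, ∀ t, 0 ≤ t → φ z t ∈ S) {α β : ℝ}
    (hsec : ∀ w, ((0 : ℝ), w) ∈ S ↔ α ≤ |w| ∧ |w| ≤ β)
    (hdir : ∀ w, ((0 : ℝ), w) ∈ S → 0 < w * (X (0, w)).1) (hα : 0 < α)
    {σ : ℝ} (hσ : |σ| = 1) (hex : ∀ z ∈ S, ∃ t, 0 < t ∧ σ * (φ z t).1 ≤ 0) :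
    ∃ (τ : Icc α β → ℝ) (P : Icc α β → Icc α β), Continuous P ∧
      ∀ i, 0 < τ i ∧ φ (0, σ * i) (τ i) = (0, -(σ * P i)) := by
  have hσ2 : σ * σ = 1 := by rw [← abs_mul_abs_self, hσ, one_mul]
  have hstart : ∀ i : Icc α β, ((0 : ℝ), σ * i) ∈ S := by
    rintro ⟨i, hi⟩
    rw [hsec, abs_mul, hσ, one_mul, abs_of_pos (hα.trans_le hi.1)]
    exact hi
  have hcurve : Continuous fun p : Icc α β × ℝ => φ (0, σ * p.1) p.2 :=
    hφc.comp (by fun_prop : Continuous fun p : Icc α β × ℝ => (((0 : ℝ), σ * (p.1 : ℝ)), p.2))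
  obtain ⟨τ, hτc, hτ⟩ := exists_continuous_hitting_time
    (x := fun (i : Icc α β) t => σ * (φ (0, σ * i) t).1)
    (y := fun (i : Icc α β) t => σ * (X (φ (0, σ * i) t)).1)
    (by fun_prop) (by fun_prop) (fun i t => (hasDerivAt_fst_of_prod (hφ _ t)).const_mul σ)
    (fun i => by simp [hφ0])
    (fun i => by
      have h := hdir _ (hstart i)
      rw [mul_right_comm] at h
      rw [hφ0]
      exact pos_of_mul_pos_left h (hα.trans_le i.2.1).le)
    (fun i => hex _ (hstart i))
    (fun i t ht h => by
      have hS := hinv _ (hstart i) t ht.le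
      have hσ0 : σ ≠ 0 := by rintro rfl; simp at hσ
      have h1 : (φ (0, σ * i) t).1 = 0 := (mul_eq_zero.mp h).resolve_left hσ0
      have h2 : φ (0, σ * i) t = (0, (φ (0, σ * i) t).2) := Prod.ext h1 rfl
      rw [h2] at hS
      have := hdir _ hS
      rw [h2]
      exact mul_ne_zero hσ0 (right_ne_zero_of_mul this.ne'))
  have hend : ∀ i : Icc α β, (φ (0, σ * i) (τ i)).1 = 0 ∧
      -(σ * (φ (0, σ * i) (τ i)).2) ∈ Icc α β := by
    intro i
    have hS := hinv _ (hstart i) (τ i) (hτ i).1.le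
    have hσ0 : σ ≠ 0 := by rintro rfl; simp at hσ
    have h1 : (φ (0, σ * i) (τ i)).1 = 0 := (mul_eq_zero.mp (hτ i).2.1).resolve_left hσ0
    have h2 : φ (0, σ * i) (τ i) = (0, (φ (0, σ * i) (τ i)).2) := Prod.ext h1 rfl
    have h3 := (hτ i).2.2
    rw [h2] at hS h3
    generalize (φ (0, σ * i) (τ i)).2 = w at hS h3 ⊢
    have h4 := hdir _ hS
    have h5 : 0 < (σ * w) * (σ * (X (0, w)).1) := by
      calc 0 < w * (X (0, w)).1 := h4
        _ = (σ * σ) * (w * (X (0, w)).1) := by rw [hσ2, one_mul]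
        _ = _ := by ring
    have h6 : σ * w < 0 := by
      by_contra! h
      exact absurd h5 (not_lt.mpr (mul_nonpos_of_nonneg_of_nonpos h h3.le))
    have h7 : -(σ * w) = |w| := by
      rw [← abs_of_neg h6, abs_mul, hσ, one_mul]
    rw [h7]
    exact ⟨h1, (hsec w).mp hS⟩
  refine ⟨τ, fun i => ⟨_, (hend i).2⟩, ?_, fun i => ⟨(hτ i).1, Prod.ext (hend i).1 ?_⟩⟩
  · have : Continuous fun i : Icc α β => φ (0, σ * i) (τ i) :=
      hcurve.comp (by fun_prop : Continuous fun i : Icc α β => (i, τ i))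
    exact Continuous.subtype_mk (by fun_prop) _
  · simp only [mul_neg, neg_neg, ← mul_assoc, hσ2, one_mul]

theorem exists_periodic_orbit_of_annulus {X : ℝ × ℝ → ℝ × ℝ} {K : NNReal} (hL : LipschitzWith K X)
    {φ : ℝ × ℝ → ℝ → ℝ × ℝ}
    (hφ0 : ∀ x, φ x 0 = x) (hφ : ∀ x t, HasDerivAt (φ x) (X (φ x t)) t)
    (hφc : Continuous fun p : (ℝ × ℝ) × ℝ => φ p.1 p.2) {S : Set (ℝ × ℝ)}
    (hinv : ∀ z ∈ S, ∀ t, 0 ≤ t → φ z t ∈ S) {α β : ℝ} (hα : 0 < α) (hαβ : α ≤ β)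
    (hsec : ∀ w, ((0 : ℝ), w) ∈ S ↔ α ≤ |w| ∧ |w| ≤ β)
    (hdir : ∀ w, ((0 : ℝ), w) ∈ S → 0 < w * (X (0, w)).1)
    (hex : ∀ σ : ℝ, |σ| = 1 → ∀ z ∈ S, ∃ t, 0 < t ∧ σ * (φ z t).1 ≤ 0) :
    ∃ (γ : ℝ → ℝ × ℝ) (T s : ℝ), 0 < T ∧ (∀ t, HasDerivAt γ (X (γ t)) t) ∧ (∀ t, γ t ∈ S) ∧
      (∀ t, γ (t + T) = γ t) ∧ (γ 0).1 = 0 ∧ 0 < (γ 0).2 ∧ (γ s).1 = 0 ∧ (γ s).2 < 0 := by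
  obtain ⟨τ₁, P₁, hP₁, h₁⟩ := exists_half_return_map hL.continuous hφ0 hφ hφc hinv hsec hdir hα
    (σ := 1) (by simp) (hex 1 (by simp))
  obtain ⟨τ₂, P₂, hP₂, h₂⟩ := exists_half_return_map hL.continuous hφ0 hφ hφc hinv hsec hdir hα
    (σ := -1) (by simp) (hex (-1) (by simp))
  obtain ⟨w, hw, hfix⟩ := exists_mem_Icc_isFixedPt_of_mapsTo
    (f := fun w => (P₂ (P₁ (projIcc α β hαβ w)) : ℝ))
    (continuous_subtype_val.comp (hP₂.comp (hP₁.comp continuous_projIcc))).continuousOn hαβ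
    (fun w _ => Subtype.coe_prop _)
  have hfix' : (P₂ (P₁ ⟨w, hw⟩) : ℝ) = w := by
    have : (P₂ (P₁ (projIcc α β hαβ w)) : ℝ) = w := hfix
    rwa [projIcc_of_mem hαβ hw] at this
  have e₁ := h₁ ⟨w, hw⟩
  have e₂ := h₂ (P₁ ⟨w, hw⟩)
  simp only [one_mul, neg_mul, neg_neg, hfix'] at e₁ e₂
  set s := τ₁ ⟨w, hw⟩
  set T := s + τ₂ (P₁ ⟨w, hw⟩) with hT
  have hTpos : 0 < T := add_pos e₁.1 e₂.1
  have hper : ∀ t, φ (0, w) (t + T) = φ (0, w) t := fun t => by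
    rw [add_comm, flow_add hL hφ0 hφ, hT, flow_add hL hφ0 hφ, e₁.2, e₂.2]
  have hwS : ((0 : ℝ), w) ∈ S := by
    rw [hsec, abs_of_pos (hα.trans_le hw.1)]
    exact hw
  refine ⟨φ (0, w), T, s, hTpos, hφ _, fun t => ?_, hper, ?_, ?_, ?_, ?_⟩
  · obtain ⟨n, hn⟩ := exists_nat_gt (-t / T)
    have hmul : φ (0, w) (t + n * T) = φ (0, w) t := (show Function.Periodic _ T from hper).nat_mul n t
    rw [← hmul]
    refine hinv _ hwS _ ?_
    rw [div_lt_iff₀ hTpos] at hn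
    linarith
  · simp [hφ0]
  · simpa [hφ0] using hα.trans_le hw.1
  · simp [e₁.2]
  · simpa [e₁.2] using hα.trans_le (P₁ ⟨w, hw⟩).2.1

theorem exists_flow_of_contDiff_on_box {Y : ℝ × ℝ → ℝ × ℝ} (hY : ContDiff ℝ 1 Y) {A B : ℝ}
    (hA : 0 ≤ A) (hB : 0 ≤ B) :
    ∃ (X : ℝ × ℝ → ℝ × ℝ) (K : NNReal) (φ : ℝ × ℝ → ℝ → ℝ × ℝ), LipschitzWith K X ∧
      (∀ z : ℝ × ℝ, |z.1| ≤ A → |z.2| ≤ B → X z = Y z) ∧ (∀ x, φ x 0 = x) ∧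
      (∀ x t, HasDerivAt (φ x) (X (φ x t)) t) ∧
      Continuous fun p : (ℝ × ℝ) × ℝ => φ p.1 p.2 := by
  let box : Set (ℝ × ℝ) := Icc (-A) A ×ˢ Icc (-B) B
  have hbox : IsCompact box := isCompact_Icc.prod isCompact_Icc
  obtain ⟨K, hK⟩ := hY.contDiffOn.exists_lipschitzOnWith one_ne_zero
    ((convex_Icc (-A) A).prod (convex_Icc (-B) B)) hbox
  obtain ⟨C, hC⟩ := hbox.exists_bound_of_continuousOn hY.continuous.continuousOn
  let r : ℝ × ℝ → ℝ × ℝ := fun z => (max (-A) (min A z.1), max (-B) (min B z.2))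
  have hr : LipschitzWith 1 r := by
    simpa using ((LipschitzWith.prod_fst.const_min A).const_max (-A)).prodMk
      ((LipschitzWith.prod_snd.const_min B).const_max (-B))
  have hrbox : ∀ z, r z ∈ box := fun z =>
    ⟨⟨le_max_left _ _, max_le (by linarith) (min_le_left _ _)⟩,
      ⟨le_max_left _ _, max_le (by linarith) (min_le_left _ _)⟩⟩
  have hX : LipschitzWith K (Y ∘ r) := by
    rw [← lipschitzOnWith_univ]
    simpa using hK.comp (hr.lipschitzOnWith (s := univ)) (fun z _ => hrbox z)
  obtain ⟨φ, h1, h2, h3⟩ := exists_global_flow (C := C.toNNReal) hX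
    (fun z => (hC _ (hrbox z)).trans (Real.le_coe_toNNReal C))
  refine ⟨Y ∘ r, K, φ, hX, fun z hz1 hz2 => ?_, h1, h2, h3⟩
  have : r z = z := by
    have h1 := abs_le.mp hz1
    have h2 := abs_le.mp hz2
    simp only [r, min_eq_right h1.2, min_eq_right h2.2, max_eq_right h1.1, max_eq_right h2.1]
  rw [Function.comp_apply, this]

theorem IsCompact.exists_pos_le_add_mul {E : Type*} [TopologicalSpace E] {S : Set E}
    (hS : IsCompact S) {P Q : E → ℝ} (hP : Continuous P) (hQ : Continuous Q)
    (hP0 : ∀ z ∈ S, 0 ≤ P z) (hPQ : ∀ z ∈ S, P z = 0 → 0 < Q z) {ε : ℝ} (hε : 0 < ε) :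
    ∃ η m, 0 < η ∧ η ≤ ε ∧ 0 < m ∧ ∀ z ∈ S, m ≤ P z + η * Q z := by
  suffices h : ∃ η, 0 < η ∧ η ≤ ε ∧ ∀ z ∈ S, 0 < P z + η * Q z by
    obtain ⟨η, h0, h1, h2⟩ := h
    rcases S.eq_empty_or_nonempty with rfl | hne
    · exact ⟨η, 1, h0, h1, one_pos, by simp⟩
    · obtain ⟨z, hz, hmin⟩ := hS.exists_isMinOn hne (f := fun z => P z + η * Q z)
        (by fun_prop)
      exact ⟨η, _, h0, h1, h2 z hz, fun y hy => hmin hy⟩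
  obtain ⟨C, hC⟩ := hS.exists_bound_of_continuousOn hQ.continuousOn
  have hS' : IsCompact (S ∩ Q ⁻¹' Iic 0) := hS.inter_right (isClosed_Iic.preimage hQ)
  rcases (S ∩ Q ⁻¹' Iic 0).eq_empty_or_nonempty with he | hne
  · refine ⟨ε, hε, le_rfl, fun z hz => ?_⟩
    have hQz : 0 < Q z := by
      by_contra! h
      have : z ∈ S ∩ Q ⁻¹' Iic 0 := ⟨hz, h⟩
      simp [he] at this
    have := hP0 z hz
    positivity
  obtain ⟨x, hx, hmin⟩ := hS'.exists_isMinOn hne hP.continuousOn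
  have hPx : 0 < P x :=
    lt_of_le_of_ne (hP0 x hx.1) fun h => absurd (hPQ x hx.1 h.symm) (not_lt.mpr hx.2)
  have hC0 : 0 ≤ C := (norm_nonneg _).trans (hC x hx.1)
  refine ⟨min ε (P x / (C + 1)), by positivity, min_le_left _ _, fun z hz => ?_⟩
  have hη : 0 < min ε (P x / (C + 1)) := by positivity
  rcases lt_or_ge 0 (Q z) with h | h
  · have := hP0 z hz
    positivity
  · have h1 : P x ≤ P z := hmin ⟨hz, h⟩
    have h2 : min ε (P x / (C + 1)) * (C + 1) ≤ P x := by
      rw [← le_div_iff₀ (by linarith)]; exact min_le_right _ _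
    have h3 := (abs_le.mp (hC z hz)).1
    nlinarith

/-- Orbits of a Liénard flow in an invariant annulus cannot stay in a half plane. -/
theorem exists_pos_time_crossing {F a g : ℝ → ℝ} (hF : Continuous F) (ha : Continuous a)
    (hg : Continuous g) (hF0 : F 0 = 0) (hapos : ∀ u, 0 < a u) (hgu : ∀ u, u ≠ 0 → 0 < u * g u)
    {φ : ℝ × ℝ → ℝ → ℝ × ℝ} {S : Set (ℝ × ℝ)} (hS : IsCompact S)
    (hinv : ∀ z ∈ S, ∀ t, 0 ≤ t → φ z t ∈ S)
    (hφ : ∀ z ∈ S, ∀ t, 0 ≤ t → HasDerivAt (φ z)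
      (((φ z t).2 - F (φ z t).1) * a (φ z t).1, -g (φ z t).1) t)
    (h0 : ((0 : ℝ), (0 : ℝ)) ∉ S) {σ : ℝ} (hσ : |σ| = 1) {z : ℝ × ℝ} (hz : z ∈ S) :
    ∃ t, 0 < t ∧ σ * (φ z t).1 ≤ 0 := by
  have hσ2 : σ * σ = 1 := by rw [← abs_mul_abs_self, hσ, one_mul]
  obtain ⟨A, hA⟩ := hS.exists_bound_of_continuousOn (f := fun z : ℝ × ℝ => z.1) (by fun_prop)
  have hA0 : 0 ≤ A := (norm_nonneg _).trans (hA z hz)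
  obtain ⟨η, m, hη, hηA, hm, hmS⟩ := hS.exists_pos_le_add_mul
    (P := fun z : ℝ × ℝ => |g z.1| / 2) (Q := fun z => z.2 * ((z.2 - F z.1) * a z.1))
    (by fun_prop) (by fun_prop) (fun _ _ => by positivity)
    (fun z hz hPz => by
      have hz1 : z.1 = 0 := by
        by_contra hne
        have : g z.1 ≠ 0 := right_ne_zero_of_mul (hgu _ hne).ne'
        have : 0 < |g z.1| / 2 := by positivity
        exact this.ne' hPz
      have hz2 : z.2 ≠ 0 := fun h => h0 (by
        have hz0 : z = (0, 0) := Prod.ext hz1 h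
        rwa [hz0] at hz)
      have := hapos 0
      rw [hz1, hF0, sub_zero, ← mul_assoc]
      have : 0 < z.2 * z.2 := mul_self_pos.mpr hz2
      positivity)
    (ε := 1 / (2 * (A + 1))) (by positivity)
  have hηA' : η * A ≤ 1 / 2 := by
    rw [le_div_iff₀ (by positivity)] at hηA
    linarith
  obtain ⟨C, hC⟩ := hS.exists_bound_of_continuousOn
    (f := fun z : ℝ × ℝ => σ * z.2 - η * (z.1 * z.2)) (by fun_prop)
  by_contra! hpos
  have hd : ∀ t, 0 ≤ t → HasDerivAt
      (fun t => σ * (φ z t).2 - η * ((φ z t).1 * (φ z t).2) + m * t)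
      (σ * -g (φ z t).1 - η * (((φ z t).2 - F (φ z t).1) * a (φ z t).1 * (φ z t).2
        + (φ z t).1 * -g (φ z t).1) + m * 1) t := fun t ht =>
    have h1 := hasDerivAt_fst_of_prod (hφ z hz t ht)
    have h2 := hasDerivAt_snd_of_prod (hφ z hz t ht)
    ((h2.const_mul σ).sub ((h1.mul h2).const_mul η)).add ((hasDerivAt_id t).const_mul m)
  have hanti : AntitoneOn (fun t => σ * (φ z t).2 - η * ((φ z t).1 * (φ z t).2) + m * t)
      (Ici 0) := by
    refine antitoneOn_of_hasDerivWithinAt_nonpos (convex_Ici 0)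
      (fun t ht => (hd t ht).continuousAt.continuousWithinAt)
      (fun t ht => (hd t (interior_subset ht)).hasDerivWithinAt) fun t ht => ?_
    rw [interior_Ici] at ht
    have hSt := hinv z hz t (le_of_lt ht)
    have h1 := hmS _ hSt
    have h2 := hA _ hSt
    have h3 := hpos t ht
    generalize φ z t = y at *
    obtain ⟨u, w⟩ := y
    simp only at *
    have hσg : σ * g u = |g u| := by
      have hne : u ≠ 0 := by rintro rfl; simp at h3
      have : 0 < σ * g u := by
        have h5 : 0 < (σ * u) * (σ * g u) := by
          calc 0 < u * g u := hgu u hne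
            _ = (σ * σ) * (u * g u) := by rw [hσ2, one_mul]
            _ = _ := by ring
        exact pos_of_mul_pos_right h5 h3.le
      rw [← abs_of_pos this, abs_mul, hσ, one_mul]
    have hσu : σ * u = |u| := by rw [← abs_of_pos h3, abs_mul, hσ, one_mul]
    have hug : u * g u = |u| * |g u| := by
      calc u * g u = (σ * σ) * (u * g u) := by rw [hσ2, one_mul]
        _ = (σ * u) * (σ * g u) := by ring
        _ = _ := by rw [hσu, hσg]
    have h6 : η * (u * g u) ≤ 1 / 2 * |g u| := by
      rw [hug, ← mul_assoc]
      refine mul_le_mul_of_nonneg_right ?_ (abs_nonneg _)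
      exact (mul_le_mul_of_nonneg_left h2 hη.le).trans hηA'
    linarith
  have ht : 0 ≤ (2 * C + 1) / m := by
    have := (norm_nonneg _).trans (hC z hz)
    positivity
  have h1 := hanti (a := 0) (b := (2 * C + 1) / m) (mem_Ici.mpr le_rfl) ht ht
  have h2 := abs_le.mp (hC _ (hinv z hz _ ht))
  have h3 := abs_le.mp (hC _ (hinv z hz 0 le_rfl))
  simp only [mul_div_cancel₀ _ hm.ne', mul_zero, add_zero] at h1
  linarith [h2.1, h3.2]

theorem exists_periodic_of_lienard {F a g : ℝ → ℝ} (hF : ContDiff ℝ 1 F) (ha : ContDiff ℝ 1 a)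
    (hg : ContDiff ℝ 1 g) (hF0 : F 0 = 0) (hapos : ∀ u, 0 < a u)
    (hgu : ∀ u, u ≠ 0 → 0 < u * g u) (hF' : deriv F 0 < 0)
    (hFtop : Tendsto F atTop atTop) (hFbot : Tendsto F atBot atBot) :
    ∃ (γ : ℝ → ℝ × ℝ) (T s : ℝ), 0 < T ∧
      (∀ t, HasDerivAt γ (((γ t).2 - F (γ t).1) * a (γ t).1, -g (γ t).1) t) ∧
      (∀ t, γ (t + T) = γ t) ∧ (γ 0).1 = 0 ∧ 0 < (γ 0).2 ∧ (γ s).1 = 0 ∧ (γ s).2 < 0 := by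
  have hFc := hF.continuous
  have hac := ha.continuous
  have hgc := hg.continuous
  have hFd : ∀ u, HasDerivAt F (deriv F u) u := fun u =>
    (hF.differentiable one_ne_zero u).hasDerivAt
  obtain ⟨G, hG0, hGd⟩ := (hgc.div₀ hac fun u => (hapos u).ne').exists_antideriv
  have hGc : Continuous G := continuous_iff_continuousAt.mpr fun u => (hGd u).continuousAt
  have hGmono : StrictMonoOn G (Ici 0) :=
    strictMonoOn_of_deriv_pos (convex_Ici 0) hGc.continuousOn fun u hu => by
      rw [interior_Ici] at hu
      rw [(hGd u).deriv]
      exact div_pos (pos_of_mul_pos_right (hgu u (ne_of_gt hu)) (le_of_lt hu)) (hapos u)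
  have hGanti : StrictAntiOn G (Iic 0) :=
    strictAntiOn_of_deriv_neg (convex_Iic 0) hGc.continuousOn fun u hu => by
      rw [interior_Iic] at hu
      rw [(hGd u).deriv]
      have : g u < 0 := neg_of_mul_pos_right (hgu u (ne_of_lt hu)) (le_of_lt hu)
      exact div_neg_of_neg_of_pos this (hapos u)
  have hGnonneg : ∀ u, 0 ≤ G u := by
    intro u
    rw [← hG0]
    rcases le_total 0 u with h | h
    · exact hGmono.monotoneOn self_mem_Ici h h
    · exact hGanti.antitoneOn h self_mem_Iic h
  obtain ⟨e, he, hGe⟩ : ∃ e, 0 < e ∧ ∀ u, G u ≤ e → deriv F u ≤ 0 := by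
    have hev := ((hF.continuous_deriv le_rfl).continuousAt (x := (0 : ℝ))).eventually_lt_const hF'
    obtain ⟨δ, hδ, hball⟩ := Metric.eventually_nhds_iff.mp hev
    refine ⟨min (G (δ / 2)) (G (-(δ / 2))), lt_min ?_ ?_, fun u hu => (hball ?_).le⟩
    · rw [← hG0]
      exact hGmono self_mem_Ici (half_pos hδ).le (half_pos hδ)
    · rw [← hG0]
      exact hGanti (mem_Iic.mpr (by linarith)) self_mem_Iic (by linarith)
    · rw [Real.dist_0_eq_abs, abs_lt]
      constructor
      · by_contra! h
        have := hGanti (a := u) (b := -(δ / 2)) (mem_Iic.mpr (by linarith))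
          (mem_Iic.mpr (by linarith)) (by linarith)
        exact absurd (hu.trans (min_le_right _ _)) this.not_ge
      · by_contra! h
        have := hGmono (a := δ / 2) (b := u) (mem_Ici.mpr (by linarith))
          (mem_Ici.mpr (by linarith)) (by linarith)
        exact absurd (hu.trans (min_le_left _ _)) this.not_ge
  obtain ⟨k, κ, c, hk0, hk, hk2, hec, htrap⟩ :=
    exists_energy_nonincreasing_above hFc hac hgc hGc hapos hgu hFtop hFbot e
  have hkc : Continuous k := continuous_iff_continuousAt.mpr fun u => (hk u).continuousAt
  have hc : 0 < c := he.trans_le hec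
  obtain ⟨p, hp⟩ := (hFtop.eventually_ge_atTop (c + 4)).exists_forall_of_atTop
  obtain ⟨n, hn⟩ := (hFbot.eventually_le_atBot (-(c + 4))).exists_forall_of_atBot
  set U := max |p| |n| with hU
  have hU0 : 0 ≤ U := (abs_nonneg _).trans (le_max_left _ _)
  have hpU : p ≤ U := (le_abs_self _).trans (le_max_left _ _)
  have hnU : -n ≤ U := (neg_le_abs _).trans (le_max_right _ _)
  obtain ⟨X, K, φ, hL, hXeq, hφ0, hφ, hφc⟩ := exists_flow_of_contDiff_on_box
    (Y := fun z : ℝ × ℝ => ((z.2 - F z.1) * a z.1, -g z.1)) (by fun_prop)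
    (A := U + 1) (B := c + 4) (by linarith) (by linarith)
  -- The four barrier functions cutting out the trapping annulus.
  let h : Fin 4 → ℝ × ℝ → ℝ := ![fun z => (z.2 - k z.1) ^ 2 / 2 + G z.1, fun z => z.1,
    fun z => -z.1, fun z => -((z.2 - F z.1) ^ 2 / 2 + G z.1)]
  let b : Fin 4 → ℝ := ![c, U, U, -e]
  let S : Set (ℝ × ℝ) := {z | ∀ i, h i z ≤ b i}
  have hS_iff : ∀ z : ℝ × ℝ, z ∈ S ↔ (z.2 - k z.1) ^ 2 / 2 + G z.1 ≤ c ∧ z.1 ≤ U ∧ -z.1 ≤ U ∧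
      -((z.2 - F z.1) ^ 2 / 2 + G z.1) ≤ -e := fun z => by
    simp [S, h, b, Fin.forall_fin_succ]
  have hcont : ∀ i, Continuous (h i) := by
    simp only [h, Fin.forall_fin_succ]
    refine ⟨?_, ?_, ?_, ?_, by simp⟩ <;> simp <;> fun_prop
  let N : Set (ℝ × ℝ) := Ioo (-(U + 1)) (U + 1) ×ˢ Ioo (-(c + 4)) (c + 4)
  have hN : IsOpen N := isOpen_Ioo.prod isOpen_Ioo
  have hSN : S ⊆ N := by
    intro z hz
    obtain ⟨h1, h2, h3, -⟩ := (hS_iff z).mp hz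
    have h4 := abs_le.mp (hk2 z.1)
    have h5 : |z.2 - k z.1| ≤ c + 1 :=
      abs_le_of_sq_le_sq (by nlinarith [hGnonneg z.1]) (by linarith)
    have h6 := abs_le.mp h5
    exact ⟨⟨by linarith, by linarith⟩, ⟨by linarith, by linarith⟩⟩
  have hXN : ∀ z ∈ N, X z = ((z.2 - F z.1) * a z.1, -g z.1) := fun z hz =>
    hXeq z (abs_le.mpr ⟨hz.1.1.le, hz.1.2.le⟩) (abs_le.mpr ⟨hz.2.1.le, hz.2.2.le⟩)
  have hφN : ∀ z t, φ z t ∈ N → HasDerivAt (φ z)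
      (((φ z t).2 - F (φ z t).1) * a (φ z t).1, -g (φ z t).1) t := fun z t hz => by
    rw [← hXN _ hz]; exact hφ z t
  have henergy : ∀ (q q' : ℝ → ℝ), (∀ u, HasDerivAt q (q' u) u) → ∀ z t, φ z t ∈ N →
      HasDerivAt (fun t => ((φ z t).2 - q (φ z t).1) ^ 2 / 2 + G (φ z t).1)
        (g (φ z t).1 * (q (φ z t).1 - F (φ z t).1) - q' (φ z t).1 * a (φ z t).1 *
          (((φ z t).2 - q (φ z t).1) * ((φ z t).2 - F (φ z t).1))) t := by
    intro q q' hq z t hz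
    have h1 := hasDerivAt_fst_of_prod (hφN z t hz)
    have h2 := hasDerivAt_snd_of_prod (hφN z t hz)
    have h3 := (((h2.sub ((hq _).comp t h1)).pow 2).div_const 2).add ((hGd _).comp t h1)
    refine h3.congr_deriv ?_
    have := (hapos (φ z t).1).ne'
    simp only [Function.comp_apply, Pi.sub_apply]
    field_simp
    ring
  let d : ℝ × ℝ → Fin 4 → ℝ → ℝ := fun z => ![
    fun t => g (φ z t).1 * (k (φ z t).1 - F (φ z t).1) - κ (φ z t).1 * a (φ z t).1 *
          (((φ z t).2 - k (φ z t).1) * ((φ z t).2 - F (φ z t).1)),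
    fun t => ((φ z t).2 - F (φ z t).1) * a (φ z t).1,
    fun t => -(((φ z t).2 - F (φ z t).1) * a (φ z t).1),
    fun t => -(g (φ z t).1 * (F (φ z t).1 - F (φ z t).1) - deriv F (φ z t).1 * a (φ z t).1 *
          (((φ z t).2 - F (φ z t).1) * ((φ z t).2 - F (φ z t).1)))]
  have hinv : ∀ z ∈ S, ∀ t, 0 ≤ t → φ z t ∈ S := by
    intro z hz
    refine forward_invariant_of_barriers (γ := φ z) (h := h) (c := b) (d := d z)
      (continuous_iff_continuousAt.mpr fun t => (hφ z t).continuousAt) hN hcont hSN ?_ ?_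
      (by rwa [hφ0])
    · simp only [Fin.forall_fin_succ]
      refine ⟨fun t ht => henergy k κ hk z t ht, fun t ht => hasDerivAt_fst_of_prod (hφN z t ht),
        fun t ht => (hasDerivAt_fst_of_prod (hφN z t ht)).neg,
        fun t ht => (henergy F _ hFd z t ht).neg, by simp⟩
    · simp only [Fin.forall_fin_succ]
      refine ⟨fun t ht hle => htrap _ _ hle, fun t ht hle => ?_, fun t ht hle => ?_,
        fun t ht hle => ?_, by simp⟩
      · have h1 : U ≤ (φ z t).1 := hle
        have h2 := hp _ (hpU.trans h1)
        exact mul_nonpos_of_nonpos_of_nonneg (by linarith [ht.2.2]) (hapos _).le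
      · have h1 : U ≤ -(φ z t).1 := hle
        have h2 := hn (φ z t).1 (by linarith)
        exact neg_nonpos.mpr (mul_nonneg (by linarith [ht.2.1]) (hapos _).le)
      · have h1 : -e ≤ -(((φ z t).2 - F (φ z t).1) ^ 2 / 2 + G (φ z t).1) := hle
        have h2 := hGe (φ z t).1 (by nlinarith [sq_nonneg ((φ z t).2 - F (φ z t).1)])
        have h3 : deriv F (φ z t).1 * a (φ z t).1 *
            (((φ z t).2 - F (φ z t).1) * ((φ z t).2 - F (φ z t).1)) ≤ 0 :=
          mul_nonpos_of_nonpos_of_nonneg (mul_nonpos_of_nonpos_of_nonneg h2 (hapos _).le)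
            (mul_self_nonneg _)
        change -(g (φ z t).1 * (F (φ z t).1 - F (φ z t).1) - deriv F (φ z t).1 * a (φ z t).1 *
          (((φ z t).2 - F (φ z t).1) * ((φ z t).2 - F (φ z t).1))) ≤ 0
        rw [sub_self, mul_zero]
        linarith
  have hS_compact : IsCompact S := by
    have hclosed : IsClosed S := by
      simp only [S, Set.ofPred_forall]
      exact isClosed_iInter fun i => isClosed_le (hcont i) continuous_const
    refine (isCompact_Icc.prod isCompact_Icc).of_isClosed_subset hclosed
      (hSN.trans (prod_mono Ioo_subset_Icc_self Ioo_subset_Icc_self))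
  have hsec : ∀ w, ((0 : ℝ), w) ∈ S ↔ √(2 * e) ≤ |w| ∧ |w| ≤ √(2 * c) := by
    intro w
    rw [hS_iff, Real.sqrt_le_left (abs_nonneg w), Real.le_sqrt (abs_nonneg w) (by linarith), sq_abs]
    simp only [hk0, hF0, hG0, sub_zero, add_zero, neg_zero, hU0, true_and, neg_le_neg_iff]
    constructor <;> rintro ⟨h1, h2⟩ <;> constructor <;> linarith
  have hα : 0 < √(2 * e) := by positivity
  have hw0 : ∀ w, ((0 : ℝ), w) ∈ S → w ≠ 0 := by
    rintro w hw rfl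
    have := ((hsec 0).mp hw).1
    rw [abs_zero] at this
    linarith
  obtain ⟨γ, T, s, hT, hγ, hγS, hper, hrest⟩ := exists_periodic_orbit_of_annulus hL hφ0 hφ hφc hinv
    hα (Real.sqrt_le_sqrt (by linarith)) hsec
    (fun w hw => by
      rw [hXN _ (hSN hw)]
      have h1 : 0 < w * w := mul_self_pos.mpr (hw0 w hw)
      have h2 := hapos 0
      simp only [hF0, sub_zero, ← mul_assoc]
      positivity)
    (fun σ hσ z hz => exists_pos_time_crossing hFc hac hgc hF0 hapos hgu hS_compact hinv
      (fun z hz t ht => hφN z t (hSN (hinv z hz t ht))) (fun h0 => hw0 0 h0 rfl) hσ hz)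
  refine ⟨γ, T, s, hT, fun t => ?_, hper, hrest⟩
  rw [← hXN _ (hSN (hγS t))]
  exact hγ t

theorem Polynomial.exists_abs_eval_div_le {p q : Polynomial ℝ} (hp : ∀ x, 0 < p.eval x)
    (hdeg : q.natDegree + 2 ≤ p.natDegree) :
    ∃ C, ∀ x, |q.eval x / p.eval x| ≤ C / (1 + x ^ 2) := by
  have hp0 : p ≠ 0 := by
    rintro rfl
    simpa using hp 0
  have hdeg' : (q * (1 + Polynomial.X ^ 2)).degree ≤ p.degree := by
    rw [Polynomial.degree_eq_natDegree hp0]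
    refine Polynomial.degree_le_of_natDegree_le (Polynomial.natDegree_mul_le.trans ?_)
    refine le_trans (Nat.add_le_add_left ?_ _) hdeg
    compute_degree
  obtain ⟨C₁, h₁⟩ := (Polynomial.isBigO_atTop_of_degree_le _ _ hdeg').bound
  obtain ⟨C₂, h₂⟩ := (Polynomial.isBigO_atBot_of_degree_le _ _ hdeg').bound
  obtain ⟨M, hM⟩ := eventually_atTop.mp h₁
  obtain ⟨m, hm⟩ := eventually_atBot.mp h₂
  have hcont : Continuous fun x => |q.eval x * (1 + x ^ 2) / p.eval x| := by
    refine continuous_abs.comp (Continuous.div₀ ?_ p.continuous fun x => (hp x).ne')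
    exact q.continuous.mul (by fun_prop)
  obtain ⟨C₃, h₃⟩ := (isCompact_Icc (a := m) (b := M)).bddAbove_image hcont.continuousOn
  have key : ∀ x, |q.eval x * (1 + x ^ 2) / p.eval x| ≤ max |C₁| (max |C₂| |C₃|) := by
    have hbig : ∀ C x, ‖(q * (1 + Polynomial.X ^ 2)).eval x‖ ≤ C * ‖p.eval x‖ →
        |q.eval x * (1 + x ^ 2) / p.eval x| ≤ |C| := by
      intro C x h
      rw [abs_div, div_le_iff₀ (abs_pos.mpr (hp x).ne')]
      refine le_trans ?_ (mul_le_mul_of_nonneg_right (le_abs_self C) (abs_nonneg _))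
      simpa using h
    intro x
    rcases le_total M x with h | h
    · exact (hbig _ _ (hM x h)).trans (le_max_left _ _)
    rcases le_total x m with h' | h'
    · exact (hbig _ _ (hm x h')).trans ((le_max_left _ _).trans (le_max_right _ _))
    · exact ((h₃ (mem_image_of_mem _ ⟨h', h⟩)).trans (le_abs_self _)).trans
        ((le_max_right _ _).trans (le_max_right _ _))
  refine ⟨max |C₁| (max |C₂| |C₃|), fun x => ?_⟩
  have hx : 0 < 1 + x ^ 2 := by positivity
  rw [le_div_iff₀ hx]
  refine le_trans (le_of_eq ?_) (key x)
  rw [mul_div_right_comm, abs_mul, abs_of_pos hx]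

theorem Polynomial.tendsto_atBot_atTop_of_even {q : Polynomial ℝ} (hq : 0 < q.natDegree)
    (heven : Even q.natDegree) (hlc : 0 < q.leadingCoeff) :
    Tendsto (fun x => q.eval x) atBot atTop := by
  have h : Tendsto (fun x => (q.comp (-Polynomial.X)).eval x) atTop atTop := by
    refine Polynomial.tendsto_atTop_of_leadingCoeff_nonneg _ ?_ ?_
    · rw [← Polynomial.natDegree_pos_iff_degree_pos, Polynomial.natDegree_comp]
      simpa using hq
    · rw [Polynomial.leadingCoeff_comp (by simp)]
      simpa [heven.neg_one_pow] using hlc.le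
  simpa [Function.comp_def] using h.comp tendsto_neg_atBot_atTop

theorem tendsto_atTop_of_le_deriv {F f : ℝ → ℝ} {c : ℝ} (hc : 0 < c)
    (hF : ∀ x, HasDerivAt F (f x) x) (hf : ∀ᶠ x in atTop, c ≤ f x) : Tendsto F atTop atTop := by
  obtain ⟨M, hM⟩ := eventually_atTop.mp hf
  refine tendsto_atTop_mono' atTop (f₁ := fun x => c * (x - M) + F M) ?_
    (tendsto_atTop_add_const_right _ _
      ((tendsto_atTop_add_const_right _ (-M) tendsto_id).const_mul_atTop hc))
  filter_upwards [eventually_ge_atTop M] with x hx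
  have := (convex_Ici M).mul_sub_le_image_sub_of_le_deriv
    (fun y _ => (hF y).continuousAt.continuousWithinAt)
    (fun y _ => (hF y).differentiableAt.differentiableWithinAt)
    (fun y hy => by
      rw [(hF y).deriv]
      exact hM y (interior_subset hy)) M self_mem_Ici x hx hx
  linarith

theorem tendsto_atBot_of_le_deriv {F f : ℝ → ℝ} {c : ℝ} (hc : 0 < c)
    (hF : ∀ x, HasDerivAt F (f x) x) (hf : ∀ᶠ x in atBot, c ≤ f x) : Tendsto F atBot atBot := by
  have h := tendsto_atTop_of_le_deriv hc (F := fun x => -F (-x)) (f := fun x => f (-x))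
    (fun x => ((hF (-x)).scomp x (hasDerivAt_neg x)).neg.congr_deriv (by simp))
    (tendsto_neg_atTop_atBot.eventually hf)
  simpa [Function.comp_def] using tendsto_neg_atTop_atBot.comp (h.comp tendsto_neg_atBot_atTop)

theorem contDiff_one_of_hasDerivAt {F f : ℝ → ℝ} (hF : ∀ x, HasDerivAt F (f x) x)
    (hf : Continuous f) : ContDiff ℝ 1 F := by
  rw [contDiff_one_iff_deriv]
  refine ⟨fun x => (hF x).differentiableAt, ?_⟩
  rwa [funext fun x => (hF x).deriv]

/-- **Polynomial existence (Theorem 3.3).** Under hypotheses H1–H5 on the real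
polynomials `p, q₁, q₂, r`, the system
`u' = v`, `v' = -q₁(u) v - (q₂(u)/p(u)) v² - r(u)/p(u)` has at least one
nonconstant periodic solution. -/
theorem existence_limit_cycle_polynomial (p q₁ q₂ r : Polynomial ℝ)
    (hH1p : ∀ x : ℝ, 0 < p.eval x)
    (hH1q : q₁.eval 0 < 0)
    (hH1r : ∀ x : ℝ, x ≠ 0 → 0 < x * r.eval x)
    (hH2 : Even q₁.natDegree ∧ 0 < q₁.leadingCoeff)
    (hH3 : q₂.natDegree + 2 ≤ p.natDegree)
    (hH4 : Odd q₂.natDegree → q₂.leadingCoeff < 0)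
    (hH5 : r.natDegree ≤ 2 * q₁.natDegree + q₂.natDegree + 1) :
    ∃ (u v : ℝ → ℝ) (T : ℝ), 0 < T ∧
      (∀ t : ℝ, HasDerivAt u (v t) t) ∧
      (∀ t : ℝ, HasDerivAt v
        (-(q₁.eval (u t) * v t) - (q₂.eval (u t) / p.eval (u t)) * v t ^ 2
          - r.eval (u t) / p.eval (u t)) t) ∧
      (∀ t : ℝ, u (t + T) = u t ∧ v (t + T) = v t) ∧
      (∃ t₁ t₂ : ℝ, (u t₁, v t₁) ≠ (u t₂, v t₂)) := by
  obtain ⟨C, hC⟩ := Polynomial.exists_abs_eval_div_le hH1p hH3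
  have hcq : Continuous fun x => q₂.eval x / p.eval x :=
    q₂.continuous.div₀ p.continuous fun x => (hH1p x).ne'
  obtain ⟨Φ, hΦ0, hΦ⟩ := hcq.exists_antideriv
  have hΦle : ∀ u, |Φ u| ≤ C * 2 := abs_le_of_deriv_le_arctan hΦ hΦ0 hC
  have hΦ1 : ContDiff ℝ 1 Φ := contDiff_one_of_hasDerivAt hΦ hcq
  have hcf : Continuous fun x => q₁.eval x * Real.exp (Φ x) :=
    q₁.continuous.mul (Real.continuous_exp.comp hΦ1.continuous)
  obtain ⟨F, hF0, hF⟩ := hcf.exists_antideriv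
  have hq₁ : 0 < q₁.natDegree := by
    rw [Nat.pos_iff_ne_zero]
    intro h
    rw [Polynomial.leadingCoeff, h, Polynomial.coeff_zero_eq_eval_zero] at hH2
    linarith [hH2.2]
  have hlarge : ∀ x, 1 ≤ q₁.eval x → Real.exp (-(C * 2)) ≤ q₁.eval x * Real.exp (Φ x) := by
    intro x hx
    have h1 : Real.exp (-(C * 2)) ≤ Real.exp (Φ x) :=
      Real.exp_le_exp.mpr (abs_le.mp (hΦle x)).1
    nlinarith [Real.exp_pos (Φ x)]
  have hFtop : Tendsto F atTop atTop := tendsto_atTop_of_le_deriv (Real.exp_pos _) hF <|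
    ((Polynomial.tendsto_atTop_of_leadingCoeff_nonneg _
      (Polynomial.natDegree_pos_iff_degree_pos.mp hq₁) hH2.2.le).eventually_ge_atTop 1).mono hlarge
  have hFbot : Tendsto F atBot atBot := tendsto_atBot_of_le_deriv (Real.exp_pos _) hF <|
    ((Polynomial.tendsto_atBot_atTop_of_even hq₁ hH2.1 hH2.2).eventually_ge_atTop 1).mono hlarge
  obtain ⟨γ, T, s, hT, hγ, hper, h01, h02, hs1, hs2⟩ :=
    exists_periodic_of_lienard (F := F) (a := fun x => Real.exp (-Φ x))
      (g := fun x => Real.exp (Φ x) * (r.eval x / p.eval x))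
      (contDiff_one_of_hasDerivAt hF hcf) hΦ1.neg.exp
      (hΦ1.exp.mul ((r.contDiff_aeval 1).div (p.contDiff_aeval 1) fun x => (hH1p x).ne')) hF0
      (fun _ => Real.exp_pos _)
      (fun x hx => by
        have h1 := hH1r x hx
        have h2 := hH1p x
        have : x * (Real.exp (Φ x) * (r.eval x / p.eval x))
            = Real.exp (Φ x) * (x * r.eval x / p.eval x) := by ring
        rw [this]
        positivity)
      (by simpa [(hF 0).deriv, hΦ0] using hH1q) hFtop hFbot
  have hu : ∀ t, HasDerivAt (fun t => (γ t).1)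
      (((γ t).2 - F (γ t).1) * Real.exp (-Φ (γ t).1)) t := fun t => hasDerivAt_fst_of_prod (hγ t)
  refine ⟨fun t => (γ t).1, fun t => ((γ t).2 - F (γ t).1) * Real.exp (-Φ (γ t).1), T, hT, hu,
    fun t => ?_, fun t => by simp only [hper, and_self], 0, s, fun h => ?_⟩
  · have hw := hasDerivAt_snd_of_prod (hγ t)
    have h := (hw.sub ((hF (γ t).1).comp t (hu t))).mul
      (((hΦ (γ t).1).comp t (hu t)).neg.exp)
    refine h.congr_deriv ?_
    have he : Real.exp (Φ (γ t).1) * Real.exp (-Φ (γ t).1) = 1 := by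
      rw [← Real.exp_add, add_neg_cancel, Real.exp_zero]
    simp only [Pi.sub_apply, Pi.neg_apply, Function.comp_apply]
    linear_combination (-(r.eval (γ t).1 / p.eval (γ t).1)
      - q₁.eval (γ t).1 * (((γ t).2 - F (γ t).1) * Real.exp (-Φ (γ t).1))) * he
  · have h := (Prod.ext_iff.mp h).2
    simp only [h01, hs1, hF0, hΦ0, sub_zero, neg_zero, Real.exp_zero, mul_one] at h
    linarith
end

section
/- Let N ≥ 1 and let f_1, f_3, …, f_{2N+1} : ℝ → ℝ be locally Lipschitz satisfying: (L1) there exists δ > 0 with f_1(x) < 0 for |x| < δ; (L2) f_{2l+1}(x) ≥ 0 for all x and all l ∈ {1,…,N}; (L3) each f_{2l+1} (l ∈ {0,…,N}) is monotone increasing on [0,∞) and monotone decreasing on (-∞,0]. Then the image Γ of any nonconstant periodic solution of the system x' = y, y' = -∑_{l=0}^{N} f_{2l+1}(x) y^{2l+1} - x is star-shaped with respect to the origin: for every unit vector e ∈ ℝ² there is exactly one ρ > 0 such that ρ·e ∈ Γ. -/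
open Set Filter Topology

theorem pos_of_linear_deriv_ge {z c r : ℝ → ℝ} {s b : ℝ} (hsb : s ≤ b) (hc : Continuous c)
    (hz : ∀ t, HasDerivAt z (c t * z t + r t) t) (hr : ∀ t ∈ Ioo s b, 0 ≤ r t)
    (hs : 0 < z s) : 0 < z b := by
  have hC : ∀ t, HasDerivAt (fun t => ∫ τ in (0 : ℝ)..t, c τ) (c t) t := fun t =>
    hc.integral_hasStrictDerivAt 0 t |>.hasDerivAt
  have hw : ∀ t, HasDerivAt (fun t => z t * Real.exp (-∫ τ in (0 : ℝ)..t, c τ))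
      (r t * Real.exp (-∫ τ in (0 : ℝ)..t, c τ)) t := fun t =>
    ((hz t).mul (hC t).fun_neg.exp).congr_deriv (by ring)
  have hmono : MonotoneOn (fun t => z t * Real.exp (-∫ τ in (0 : ℝ)..t, c τ)) (Icc s b) := by
    refine monotoneOn_of_deriv_nonneg (convex_Icc s b)
      (fun t _ => (hw t).continuousAt.continuousWithinAt)
      (fun t _ => (hw t).differentiableAt.differentiableWithinAt) fun t ht => ?_
    rw [interior_Icc] at ht
    rw [(hw t).deriv]
    exact mul_nonneg (hr t ht) (Real.exp_pos _).le
  have h := hmono (left_mem_Icc.2 hsb) (right_mem_Icc.2 hsb) hsb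
  exact pos_of_mul_pos_left (lt_of_lt_of_le (mul_pos hs (Real.exp_pos _)) h) (Real.exp_pos _).le

theorem div_pos_of_ne_zero_on_Ioc {u : ℝ → ℝ} (hu : Continuous u) {s b : ℝ}
    (hne : ∀ t ∈ Ioc s b, u t ≠ 0) {t : ℝ} (ht : t ∈ Ioc s b) : 0 < u t / u b := by
  by_contra! hle
  have hb : u b ≠ 0 := hne b ⟨ht.1.trans_le ht.2, le_rfl⟩
  obtain ⟨τ, hτ, hzero⟩ := intermediate_value_Icc ht.2
    (f := fun τ => u τ / u b) (hu.div_const _).continuousOn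
    (show (0 : ℝ) ∈ Icc _ _ from ⟨hle, by rw [div_self hb]; exact zero_le_one⟩)
  exact hne τ ⟨ht.1.trans_le hτ.1, hτ.2⟩ ((div_eq_zero_iff.1 hzero).resolve_right hb)

theorem deriv_nonneg_of_pos_right {u : ℝ → ℝ} {u' s b : ℝ} (hsb : s < b)
    (hu : HasDerivAt u u' s) (hs : u s = 0) (hpos : ∀ t ∈ Ioc s b, 0 < u t) : 0 ≤ u' := by
  have h := (hasDerivWithinAt_iff_tendsto_slope' self_notMem_Ioi).1
    (hu.hasDerivWithinAt (s := Ioi s))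
  refine ge_of_tendsto h ?_
  filter_upwards [Ioc_mem_nhdsGT hsb] with t ht
  rw [slope_def_field, hs, sub_zero]
  exact div_nonneg (hpos t ht).le (sub_nonneg.2 ht.1.le)

theorem nonneg_left_of_pos_on_Ioc {u : ℝ → ℝ} {s b : ℝ} (hsb : s < b)
    (hu : ContinuousAt u s) (hpos : ∀ t ∈ Ioc s b, 0 < u t) : 0 ≤ u s :=
  ge_of_tendsto (hu.tendsto.mono_left nhdsWithin_le_nhds : Tendsto u (𝓝[>] s) (𝓝 (u s)))
    (by filter_upwards [Ioc_mem_nhdsGT hsb] with t ht using (hpos t ht).le)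

theorem dampingCoeff_mono_on_rays {N : ℕ} {f : ℕ → ℝ → ℝ}
    (hnonneg : ∀ l, 1 ≤ l → l ≤ N → ∀ x : ℝ, 0 ≤ f l x)
    (hmono : ∀ l ≤ N, MonotoneOn (f l) (Ici 0) ∧ AntitoneOn (f l) (Iic 0))
    (X Y : ℝ) {a b : ℝ} (ha : 0 ≤ a) (hab : a ≤ b) :
    ∑ l ∈ Finset.range (N + 1), f l (a * X) * (a * Y) ^ (2 * l) ≤
      ∑ l ∈ Finset.range (N + 1), f l (b * X) * (b * Y) ^ (2 * l) := by
  refine Finset.sum_le_sum fun l hl => ?_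
  have hlN : l ≤ N := Nat.lt_succ_iff.1 (Finset.mem_range.1 hl)
  have hb : 0 ≤ b := ha.trans hab
  have hf : f l (a * X) ≤ f l (b * X) := by
    rcases le_total 0 X with hX | hX
    · exact (hmono l hlN).1 (mul_nonneg ha hX) (mul_nonneg hb hX)
        (mul_le_mul_of_nonneg_right hab hX)
    · exact (hmono l hlN).2 (mul_nonpos_of_nonneg_of_nonpos hb hX)
        (mul_nonpos_of_nonneg_of_nonpos ha hX) (mul_le_mul_of_nonpos_right hab hX)
  rcases Nat.eq_zero_or_pos l with rfl | hl0
  · simpa using hf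
  · refine mul_le_mul hf ?_ ((even_two_mul l).pow_nonneg _) (hnonneg l hl0 hlN _)
    rw [mul_pow, mul_pow]
    gcongr
    exact (even_two_mul l).pow_nonneg _

theorem exists_last_axis_crossing {x y : ℝ → ℝ} {T : ℝ} (hT : 0 < T)
    (hx : ∀ t, HasDerivAt x (y t) t) (hy : Continuous y) {t₀ : ℝ}
    (hper : x (t₀ - T) = x t₀) (hne : x t₀ * y t₀ ≠ 0) :
    ∃ s < t₀, x s * y s = 0 ∧ ∀ t ∈ Ioc s t₀, 0 < x t / x t₀ ∧ 0 < y t / y t₀ := by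
  have hxc : Continuous x := continuous_iff_continuousAt.2 fun t => (hx t).continuousAt
  have hcomp : IsCompact (Icc (t₀ - T) t₀ ∩ {t | x t * y t = 0}) :=
    isCompact_Icc.inter_right (isClosed_eq (hxc.mul hy) continuous_const)
  obtain ⟨c, hc, hc0⟩ := exists_hasDerivAt_eq_zero (sub_lt_self t₀ hT) hxc.continuousOn hper
    fun t _ => hx t
  obtain ⟨s, ⟨hs, hs0⟩, hmax⟩ := hcomp.exists_isGreatest
    ⟨c, Ioo_subset_Icc_self hc, by simp [hc0]⟩
  have hlt : s < t₀ := lt_of_le_of_ne hs.2 (by rintro rfl; exact hne hs0)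
  have hnz : ∀ t ∈ Ioc s t₀, x t * y t ≠ 0 := fun t ht h0 =>
    (hmax ⟨⟨hs.1.trans ht.1.le, ht.2⟩, h0⟩).not_gt ht.1
  exact ⟨s, hlt, hs0, fun t ht =>
    ⟨div_pos_of_ne_zero_on_Ioc hxc (fun τ hτ => left_ne_zero_of_mul (hnz τ hτ)) ht,
      div_pos_of_ne_zero_on_Ioc hy (fun τ hτ => right_ne_zero_of_mul (hnz τ hτ)) ht⟩⟩

theorem angular_momentum_neg {N : ℕ} {f : ℕ → ℝ → ℝ}
    (hcont : ∀ l ≤ N, Continuous (f l))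
    (hnonneg : ∀ l, 1 ≤ l → l ≤ N → ∀ x : ℝ, 0 ≤ f l x)
    (hmono : ∀ l ≤ N, MonotoneOn (f l) (Ici 0) ∧ AntitoneOn (f l) (Iic 0))
    {x y : ℝ → ℝ} {T : ℝ} (hT : 0 < T)
    (hx : ∀ t : ℝ, HasDerivAt x (y t) t)
    (hy : ∀ t : ℝ, HasDerivAt y
      (-(∑ l ∈ Finset.range (N + 1), f l (x t) * y t ^ (2 * l + 1)) - x t) t)
    (hper : ∀ t, x (t + T) = x t)
    (hne : ∀ t, ¬(x t = 0 ∧ y t = 0)) (t₀ : ℝ) :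
    x t₀ * (-(∑ l ∈ Finset.range (N + 1), f l (x t₀) * y t₀ ^ (2 * l + 1)) - x t₀)
      - y t₀ * y t₀ < 0 := by
  have hxc : Continuous x := continuous_iff_continuousAt.2 fun t => (hx t).continuousAt
  have hyc : Continuous y := continuous_iff_continuousAt.2 fun t => (hy t).continuousAt
  have hsum : ∀ u v : ℝ, ∑ l ∈ Finset.range (N + 1), f l u * v ^ (2 * l + 1) =
      v * ∑ l ∈ Finset.range (N + 1), f l u * v ^ (2 * l) := fun u v => by
    rw [Finset.mul_sum]
    exact Finset.sum_congr rfl fun l _ => by ring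
  by_contra! hcon
  rw [hsum] at hcon
  have hnz : x t₀ * y t₀ ≠ 0 := fun h0 => by
    have := hne t₀
    rcases mul_eq_zero.1 h0 with h | h
    · rw [h] at hcon
      have : y t₀ ≠ 0 := fun h' => this ⟨h, h'⟩
      have := mul_self_pos.2 this
      linarith
    · rw [h] at hcon
      have : x t₀ ≠ 0 := fun h' => this ⟨h', h⟩
      have := mul_self_pos.2 this
      linarith
  obtain ⟨s, hst, hs0, hpos⟩ := exists_last_axis_crossing hT hx hyc
    (by simpa using (hper (t₀ - T)).symm) hnz
  generalize hX : x t₀ = X at *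
  generalize hY : y t₀ = Y at *
  have hX0 : X ≠ 0 := left_ne_zero_of_mul hnz
  have hY0 : Y ≠ 0 := right_ne_zero_of_mul hnz
  have hlam0 : 0 ≤ x s / X := nonneg_left_of_pos_on_Ioc (u := fun t => x t / X) hst
    (hxc.div_const _).continuousAt fun t ht => (hpos t ht).1
  have hmu0 : 0 ≤ y s / Y := nonneg_left_of_pos_on_Ioc (u := fun t => y t / Y) hst
    (hyc.div_const _).continuousAt fun t ht => (hpos t ht).2
  have hlam : ∀ t, HasDerivAt (fun t => x t / X) (y t / Y * (Y / X)) t := fun t =>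
    ((hx t).div_const X).congr_deriv (by field_simp)
  have hcases : 0 < X * y s - Y * x s ∧ ∀ t ∈ Ioo s t₀,
      X * Y * ∑ l ∈ Finset.range (N + 1), f l (x t / X * X) * (x t / X * Y) ^ (2 * l) ≤
      X * Y * ∑ l ∈ Finset.range (N + 1), f l X * Y ^ (2 * l) := by
    have hz : X * y s - Y * x s = X * Y * (y s / Y - x s / X) := by field_simp
    rw [hz]
    rcases lt_or_gt_of_ne hnz with hneg | hposXY
    · have hk : Y / X ≤ 0 := by
        rw [show Y / X = X * Y / (X * X) by field_simp]
        exact div_nonpos_of_nonpos_of_nonneg hneg.le (mul_self_nonneg X)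
      have hanti : AntitoneOn (fun t => x t / X) (Icc s t₀) := by
        refine antitoneOn_of_deriv_nonpos (convex_Icc _ _)
          (hxc.div_const _).continuousOn
          (fun t _ => (hlam t).differentiableAt.differentiableWithinAt) fun t ht => ?_
        rw [interior_Icc] at ht
        rw [(hlam t).deriv]
        exact mul_nonpos_of_nonneg_of_nonpos (hpos t (Ioo_subset_Ioc_self ht)).2.le hk
      have hge : ∀ t ∈ Icc s t₀, 1 ≤ x t / X := fun t ht => by
        have := hanti ht (right_mem_Icc.2 hst.le) ht.2
        simpa only [hX, div_self hX0] using this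
      have h1 := hge s (left_mem_Icc.2 hst.le)
      have hxs : x s ≠ 0 := fun h => by rw [h] at h1; norm_num at h1
      have hys : y s = 0 := (mul_eq_zero.1 hs0).resolve_left hxs
      refine ⟨mul_pos_of_neg_of_neg hneg (by rw [hys]; linarith [zero_div Y]), fun t ht => ?_⟩
      refine mul_le_mul_of_nonpos_left ?_ hneg.le
      simpa using dampingCoeff_mono_on_rays hnonneg hmono X Y zero_le_one
        (hge t (Ioo_subset_Icc_self ht))
    · have hk : 0 ≤ Y / X := by
        rw [show Y / X = X * Y / (X * X) by field_simp]
        exact div_nonneg hposXY.le (mul_self_nonneg X)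
      have hmon : MonotoneOn (fun t => x t / X) (Icc s t₀) := by
        refine monotoneOn_of_deriv_nonneg (convex_Icc _ _)
          (hxc.div_const _).continuousOn
          (fun t _ => (hlam t).differentiableAt.differentiableWithinAt) fun t ht => ?_
        rw [interior_Icc] at ht
        rw [(hlam t).deriv]
        exact mul_nonneg (hpos t (Ioo_subset_Ioc_self ht)).2.le hk
      have hle : ∀ t ∈ Icc s t₀, x t / X ≤ 1 := fun t ht => by
        have := hmon ht (right_mem_Icc.2 hst.le) ht.2
        simpa only [hX, div_self hX0] using this
      have hys : y s ≠ 0 := fun h => by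
        have hxs : x s ≠ 0 := fun h' => hne s ⟨h', h⟩
        have hd := deriv_nonneg_of_pos_right (u := fun t => y t / Y) hst ((hy s).div_const Y)
          (by simp [h]) fun t ht => (hpos t ht).2
        simp only [h, ne_eq, Nat.add_eq_zero_iff, one_ne_zero, and_false, not_false_eq_true,
          zero_pow, mul_zero, Finset.sum_const_zero, neg_zero, zero_sub] at hd
        have h1 : 0 < x s / X := lt_of_le_of_ne hlam0 (div_ne_zero hxs hX0).symm
        have h2 : 0 < x s / Y := by
          rw [show x s / Y = x s / X * (X * Y) / (Y * Y) by field_simp]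
          exact div_pos (mul_pos h1 hposXY) (mul_self_pos.2 hY0)
        rw [neg_div] at hd
        linarith
      have hxs : x s = 0 := (mul_eq_zero.1 hs0).resolve_right hys
      have hmu : 0 < y s / Y := lt_of_le_of_ne hmu0 (div_ne_zero hys hY0).symm
      refine ⟨mul_pos hposXY (by rw [hxs]; linarith [zero_div X]), fun t ht => ?_⟩
      refine mul_le_mul_of_nonneg_left ?_ hposXY.le
      simpa using dampingCoeff_mono_on_rays hnonneg hmono X Y
        (hpos t (Ioo_subset_Ioc_self ht)).1.le (hle t (Ioo_subset_Icc_self ht))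
  let S : ℝ → ℝ := fun t => ∑ l ∈ Finset.range (N + 1), f l (x t) *
    ∑ i ∈ Finset.range (2 * l + 1), y t ^ i * (x t / X * Y) ^ (2 * l + 1 - 1 - i)
  have hS : Continuous S := continuous_finsetSum _ fun l hl =>
    ((hcont l (Nat.lt_succ_iff.1 (Finset.mem_range.1 hl))).comp hxc).mul (by fun_prop)
  have hSeq : ∀ t, ∑ l ∈ Finset.range (N + 1), f l (x t) * y t ^ (2 * l + 1) =
      S t * (y t - x t / X * Y) +
        ∑ l ∈ Finset.range (N + 1), f l (x t) * (x t / X * Y) ^ (2 * l + 1) := fun t => by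
    simp only [S]
    rw [Finset.sum_mul, ← Finset.sum_add_distrib]
    refine Finset.sum_congr rfl fun l _ => ?_
    rw [mul_assoc, (Commute.all _ _).geom_sum₂_mul]
    ring
  let r : ℝ → ℝ := fun t => x t / X *
    (-(X * Y * ∑ l ∈ Finset.range (N + 1), f l (x t) * (x t / X * Y) ^ (2 * l))
      - X * X - Y * Y)
  have hz : ∀ t, HasDerivAt (fun t => X * y t - Y * x t)
      ((-S t - Y / X) * (X * y t - Y * x t) + r t) t := fun t => by
    refine (((hy t).const_mul X).sub ((hx t).const_mul Y)).congr_deriv ?_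
    rw [hSeq, hsum]
    simp only [r]
    generalize ∑ l ∈ Finset.range (N + 1), f l (x t) * (x t / X * Y) ^ (2 * l) = G
    field_simp
    ring
  have hfin := pos_of_linear_deriv_ge hst.le (by fun_prop) hz (fun t ht => by
    refine mul_nonneg (hpos t (Ioo_subset_Ioc_self ht)).1.le ?_
    have h := hcases.2 t ht
    rw [div_mul_cancel₀ _ hX0] at h
    linarith) hcases.1
  simp only [hX, hY] at hfin
  linarith

theorem eq_of_autonomous_of_locallyLipschitz {E : Type*} [NormedAddCommGroup E] [NormedSpace ℝ E]
    {V : E → E} (hV : LocallyLipschitz V) {c₁ c₂ : ℝ → E}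
    (h₁ : ∀ t, HasDerivAt c₁ (V (c₁ t)) t) (h₂ : ∀ t, HasDerivAt c₂ (V (c₂ t)) t)
    {t₀ : ℝ} (h₀ : c₁ t₀ = c₂ t₀) : c₁ = c₂ := by
  have hc₁ : Continuous c₁ := continuous_iff_continuousAt.2 fun t => (h₁ t).continuousAt
  have hc₂ : Continuous c₂ := continuous_iff_continuousAt.2 fun t => (h₂ t).continuousAt
  have hopen : IsOpen {t | c₁ t = c₂ t} := by
    refine isOpen_iff_mem_nhds.2 fun t ht => ?_
    obtain ⟨K, U, hU, hK⟩ := hV (c₁ t)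
    have hU₂ : U ∈ 𝓝 (c₂ t) := by rwa [← show c₁ t = c₂ t from ht]
    exact ODE_solution_unique_of_eventually (v := fun _ => V) (s := fun _ => U) (K := K)
      (Eventually.of_forall fun _ => hK)
      (by filter_upwards [hc₁.continuousAt hU] with τ hτ using ⟨h₁ τ, hτ⟩)
      (by filter_upwards [hc₂.continuousAt hU₂] with τ hτ using ⟨h₂ τ, hτ⟩) ht
  have huniv := (show IsClopen {t | c₁ t = c₂ t} from ⟨isClosed_eq hc₁ hc₂, hopen⟩).eq_univ ⟨t₀, h₀⟩
  exact funext fun t => (huniv ▸ mem_univ t : t ∈ {t | c₁ t = c₂ t})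

theorem periodic_of_autonomous_of_eq {E : Type*} [NormedAddCommGroup E] [NormedSpace ℝ E]
    {V : E → E} (hV : LocallyLipschitz V) {c : ℝ → E} (hc : ∀ t, HasDerivAt c (V (c t)) t)
    {t P : ℝ} (h : c (t + P) = c t) : Function.Periodic c P :=
  congrFun (eq_of_autonomous_of_locallyLipschitz hV (c₁ := fun t => c (t + P))
    (fun t => (hc (t + P)).comp_add_const t P) hc h)

theorem exists_add_eq_of_iterate_eq {v : ℝ → ℝ} (hv : Continuous v) (a : ℝ) {k : ℕ} (hk : 0 < k)
    (h : v (k * a) = v 0) : ∃ θ, v (θ + a) = v θ := by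
  have htel : ∑ j ∈ Finset.range k, (v (j * a + a) - v (j * a)) = 0 := by
    have := Finset.sum_range_sub (fun j : ℕ => v (j * a)) k
    simp only [Nat.cast_add, Nat.cast_one, add_mul, one_mul, Nat.cast_zero, zero_mul, h,
      sub_self] at this
    exact this
  have hne : (Finset.range k).Nonempty := Finset.nonempty_range_iff.2 hk.ne'
  obtain ⟨θ, hθ⟩ := mem_range_of_exists_le_of_exists_ge (c := (0 : ℝ))
    (f := fun θ => v (θ + a) - v θ) (by fun_prop)
    (by
      by_contra! hcon
      exact (Finset.sum_pos (fun (j : ℕ) _ => hcon (j * a)) hne).ne' htel)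
    (by
      by_contra! hcon
      exact (Finset.sum_neg (fun (j : ℕ) _ => hcon (j * a)) hne).ne htel)
  exact ⟨θ, sub_eq_zero.1 hθ⟩

theorem exists_log_lift {c w : ℝ → ℂ} (hw : Continuous w)
    (hc : ∀ t, HasDerivAt c (w t * c t) t) (h0 : c 0 ≠ 0) :
    ∃ L : ℝ → ℂ, (∀ t, HasDerivAt L (w t) t) ∧ ∀ t, Complex.exp (L t) = c t := by
  let L : ℝ → ℂ := fun t => Complex.log (c 0) + ∫ τ in (0 : ℝ)..t, w τ
  have hL : ∀ t, HasDerivAt L (w t) t := fun t =>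
    (hw.integral_hasStrictDerivAt 0 t).hasDerivAt.const_add _
  refine ⟨L, hL, fun t => ?_⟩
  have hd : ∀ t, HasDerivAt (fun t => c t * Complex.exp (-L t)) 0 t := fun t =>
    ((hc t).mul (hL t).fun_neg.cexp).congr_deriv (by ring)
  have hconst := is_const_of_deriv_eq_zero (fun t => (hd t).differentiableAt)
    (fun t => (hd t).deriv) t 0
  have hL0 : L 0 = Complex.log (c 0) := by simp [L]
  simp only [hL0, Complex.exp_neg, Complex.exp_log h0, mul_inv_cancel₀ h0] at hconst
  exact (eq_of_mul_inv_eq_one hconst).symm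

theorem log_lift_add_period {c w L : ℝ → ℂ} (hL : ∀ t, HasDerivAt L (w t) t)
    (hexp : ∀ t, Complex.exp (L t) = c t) {P : ℝ} (hc : Function.Periodic c P)
    (hw : Function.Periodic w P) :
    ∃ n : ℤ, ∀ t, L (t + P) = L t + n * (2 * Real.pi * Complex.I) := by
  obtain ⟨n, hn⟩ := Complex.exp_eq_exp_iff_exists_int.1
    (show Complex.exp (L (0 + P)) = Complex.exp (L 0) by rw [hexp, hexp, hc])
  have hd : ∀ t, HasDerivAt (fun t => L (t + P) - L t) 0 t := fun t =>
    (((hL (t + P)).comp_add_const t P).sub (hL t)).congr_deriv (by rw [hw, sub_self])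
  refine ⟨n, fun t => ?_⟩
  have hconst := is_const_of_deriv_eq_zero (fun t => (hd t).differentiableAt)
    (fun t => (hd t).deriv) t 0
  rw [hn] at hconst
  linear_combination hconst

theorem existsUnique_radius_of_periodic_of_rotating {V : ℂ → ℂ} (hV : LocallyLipschitz V)
    {c : ℝ → ℂ} (hc : ∀ t, HasDerivAt c (V (c t)) t) (hne : ∀ t, c t ≠ 0)
    {T : ℝ} (hT : 0 < T) (hper : Function.Periodic c T)
    (hrot : ∀ t, (V (c t) / c t).im < 0) {e : ℂ} (he : ‖e‖ = 1) :
    ∃! ρ : ℝ, 0 < ρ ∧ (ρ : ℂ) * e ∈ range c := by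
  have hcc : Continuous c := continuous_iff_continuousAt.2 fun t => (hc t).continuousAt
  obtain ⟨L, hL, hexp⟩ := exists_log_lift (w := fun t => V (c t) / c t)
    ((hV.continuous.comp hcc).div hcc hne)
    (fun t => (hc t).congr_deriv (div_mul_cancel₀ _ (hne t)).symm) (hne 0)
  have hLc : Continuous L := continuous_iff_continuousAt.2 fun t => (hL t).continuousAt
  have hshift : ∀ {P : ℝ}, Function.Periodic c P →
      ∃ n : ℤ, ∀ t, L (t + P) = L t + n * (2 * Real.pi * Complex.I) := fun hP =>
    log_lift_add_period hL hexp hP fun t => by simp only [hP t]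
  let φ : ℝ → ℝ := fun t => -(L t).im
  have hφc : Continuous φ := (Complex.continuous_im.comp hLc).neg
  have hφ : StrictMono φ := by
    have hd : ∀ t, HasDerivAt φ (-(V (c t) / c t).im) t := fun t =>
      (Complex.imCLM.hasFDerivAt.comp_hasDerivAt t (hL t)).neg
    refine strictMono_of_deriv_pos fun t => ?_
    rw [(hd t).deriv]
    exact neg_pos.2 (hrot t)
  have hπ := Real.two_pi_pos
  obtain ⟨n, hn⟩ := hshift hper
  have hnim : ∀ t, φ (t + T) = φ t - n * (2 * Real.pi) := fun t => by
    simp [φ, hn]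
    ring
  have hn0 : n < 0 := by
    have h := hφ (lt_add_of_pos_right 0 hT)
    rw [hnim] at h
    have : (n : ℝ) < 0 := by nlinarith
    exact_mod_cast this
  obtain ⟨k, hk⟩ := Int.eq_ofNat_of_zero_le (neg_nonneg.2 hn0.le)
  have hkn : (k : ℝ) = -n := by exact_mod_cast hk.symm
  have hk0 : 0 < k := by omega
  have hφT : ∀ t, φ (t + T) = φ t + k * (2 * Real.pi) := fun t => by
    rw [hnim, hkn]
    ring
  have hiter : ∀ {P a : ℝ}, (∀ t, φ (t + P) = φ t + a) → ∀ (m : ℤ) t,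
      φ (t + m * P) = φ t + m * a := fun {P a} h m t => by
    induction m with
    | zero => simp
    | succ i ih =>
      have := h (t + i * P)
      push_cast at ih ⊢
      rw [add_one_mul, ← add_assoc, this, ih]
      ring
    | pred i ih =>
      have := h (t + (-i - 1) * P)
      push_cast at ih ⊢
      rw [show t + (-i - 1) * P + P = t + -i * P by ring, ih] at this
      linarith
  have hsurj : Function.Surjective φ := fun b => by
    have hpos : 0 < k * (2 * Real.pi) := by positivity
    refine mem_range_of_exists_le_of_exists_ge hφc ?_ ?_
    · obtain ⟨m, hm⟩ := exists_int_lt ((b - φ 0) / (k * (2 * Real.pi)))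
      refine ⟨0 + m * T, ?_⟩
      rw [hiter hφT]
      have := (lt_div_iff₀ hpos).1 hm
      linarith
    · obtain ⟨m, hm⟩ := exists_int_gt ((b - φ 0) / (k * (2 * Real.pi)))
      refine ⟨0 + m * T, ?_⟩
      rw [hiter hφT]
      have := (div_lt_iff₀ hpos).1 hm
      linarith
  let τ : ℝ ≃o ℝ := (hφ.orderIsoOfSurjective φ hsurj).symm
  have hφτ : ∀ θ, φ (τ θ) = θ := fun θ =>
    (hφ.orderIsoOfSurjective φ hsurj).apply_symm_apply θ
  obtain ⟨θ, hθ⟩ := exists_add_eq_of_iterate_eq (v := fun θ => (L (τ θ)).re)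
    (Complex.continuous_re.comp (hLc.comp τ.continuous)) (2 * Real.pi) hk0 (by
      have : τ (k * (2 * Real.pi)) = τ 0 + T := hφ.injective (by
        rw [hφT, hφτ, hφτ, zero_add])
      simp [this, hn])
  have hLθ : L (τ (θ + 2 * Real.pi)) = L (τ θ) - 2 * Real.pi * Complex.I := by
    have h₁ := hφτ (θ + 2 * Real.pi)
    have h₂ := hφτ θ
    simp only [φ] at h₁ h₂
    refine Complex.ext ?_ ?_
    · simpa using hθ
    · simp
      linarith
  let P : ℝ := τ (θ + 2 * Real.pi) - τ θ
  have hP : τ θ + P = τ (θ + 2 * Real.pi) := by simp [P]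
  have hcP : Function.Periodic c P := periodic_of_autonomous_of_eq hV hc (t := τ θ) (by
    rw [hP, ← hexp, hLθ, Complex.exp_periodic.sub_eq, hexp])
  have hφP : ∀ t, φ (t + P) = φ t + 2 * Real.pi := by
    obtain ⟨j, hj⟩ := hshift hcP
    have hjφ : ∀ t, φ (t + P) = φ t - j * (2 * Real.pi) := fun t => by
      simp [φ, hj]
      ring
    have := hjφ (τ θ)
    rw [hP, hφτ, hφτ] at this
    intro t
    rw [hjφ]
    linarith
  obtain ⟨t, ht⟩ := hsurj (-e.arg)
  have hearg : (e : ℂ) = Complex.exp (e.arg * Complex.I) := by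
    have := Complex.norm_mul_exp_arg_mul_I e
    rw [he] at this
    simpa using this.symm
  have hexpabs : ∀ t, c t = (Real.exp (L t).re : ℂ) * Complex.exp ((L t).im * Complex.I) :=
    fun t => by rw [← hexp, Complex.ofReal_exp, ← Complex.exp_add, Complex.re_add_im]
  have htc : c t = (Real.exp (L t).re : ℂ) * e := by
    rw [hexpabs, hearg, show (L t).im = e.arg by simpa [φ] using ht]
  refine ⟨Real.exp (L t).re, ⟨Real.exp_pos _, t, htc⟩, ?_⟩
  rintro ρ ⟨hρ, t', ht'⟩
  have he0 : e ≠ 0 := fun h => by simp [h] at he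
  have hct' : Complex.exp (L t') = Complex.exp (Real.log ρ + e.arg * Complex.I) := by
    rw [hexp, ht', Complex.exp_add, ← hearg, ← Complex.ofReal_exp, Real.exp_log hρ]
  obtain ⟨m, hm⟩ := Complex.exp_eq_exp_iff_exists_int.1 hct'
  have hφt' : φ t' = φ (t + (-m : ℤ) * P) := by
    rw [hiter hφP, ht]
    simp [φ, hm]
    ring
  have hcc' : c t' = c t := by rw [hφ.injective hφt', hcP.int_mul (-m) t]
  rw [ht', htc] at hcc'
  exact_mod_cast mul_right_cancel₀ he0 hcc'

theorem locallyLipschitz_sum {α E ι : Type*} [PseudoEMetricSpace α] [SeminormedAddCommGroup E]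
    {s : Finset ι} {g : ι → α → E} (h : ∀ i ∈ s, LocallyLipschitz (g i)) :
    LocallyLipschitz fun a => ∑ i ∈ s, g i a := by
  classical
  induction s using Finset.induction_on with
  | empty => simpa using LocallyLipschitz.const (0 : E)
  | insert i s his ih =>
    simp only [Finset.sum_insert his]
    exact (h i (Finset.mem_insert_self i s)).add
      (ih fun j hj => h j (Finset.mem_insert_of_mem hj))

/-- The vector field of `x' = y`, `y' = -∑ l ≤ N, f l x * y ^ (2 * l + 1) - x`, on the plane
identified with `ℂ`. -/
noncomputable def lienardField (N : ℕ) (f : ℕ → ℝ → ℝ) (z : ℂ) : ℂ :=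
  Complex.equivRealProdCLM.symm
    (z.im, -(∑ l ∈ Finset.range (N + 1), f l z.re * z.im ^ (2 * l + 1)) - z.re)

theorem locallyLipschitz_lienardField {N : ℕ} {f : ℕ → ℝ → ℝ}
    (hlip : ∀ l ≤ N, LocallyLipschitz (f l)) : LocallyLipschitz (lienardField N f) := by
  have hre : LocallyLipschitz Complex.re := Complex.reCLM.lipschitz.locallyLipschitz
  have him : LocallyLipschitz Complex.im := Complex.imCLM.lipschitz.locallyLipschitz
  have hmul : ∀ k : ℕ, LocallyLipschitz fun p : ℝ × ℝ => p.1 * p.2 ^ k := fun k =>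
    ContDiff.locallyLipschitz (𝕂 := ℝ) (by fun_prop)
  have hsub : LocallyLipschitz fun p : ℝ × ℝ => -p.1 - p.2 :=
    ContDiff.locallyLipschitz (𝕂 := ℝ) (by fun_prop)
  have hsum : LocallyLipschitz fun z : ℂ =>
      ∑ l ∈ Finset.range (N + 1), f l z.re * z.im ^ (2 * l + 1) :=
    locallyLipschitz_sum fun l hl =>
      (hmul (2 * l + 1)).comp
        (((hlip l (Nat.lt_succ_iff.1 (Finset.mem_range.1 hl))).comp hre).prodMk him)
  exact Complex.equivRealProdCLM.symm.lipschitz.locallyLipschitz.comp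
    (him.prodMk (hsub.comp (hsum.prodMk hre)))


/-- **Star-shapedness of the limit cycle.** Under hypotheses L1–L3, the image
of any nonconstant periodic solution of
`x' = y`, `y' = -∑_{l=0}^N f_{2l+1}(x) y^(2l+1) - x` is star-shaped with
respect to the origin: every ray from the origin meets it in exactly one
point.  Here `f l` denotes `f_{2l+1}`. -/
theorem massera_generalized_star_shaped (N : ℕ) (hN : 1 ≤ N)
    (f : ℕ → ℝ → ℝ)
    (hlip : ∀ l ≤ N, LocallyLipschitz (f l))
    (hL1 : ∃ δ > 0, ∀ x : ℝ, |x| < δ → f 0 x < 0)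
    (hL2 : ∀ l, 1 ≤ l → l ≤ N → ∀ x : ℝ, 0 ≤ f l x)
    (hL3 : ∀ l ≤ N, MonotoneOn (f l) (Set.Ici 0) ∧ AntitoneOn (f l) (Set.Iic 0))
    (x y : ℝ → ℝ) (T : ℝ) (hT : 0 < T)
    (hx : ∀ t : ℝ, HasDerivAt x (y t) t)
    (hy : ∀ t : ℝ, HasDerivAt y
      (-(∑ l ∈ Finset.range (N + 1), f l (x t) * y t ^ (2 * l + 1)) - x t) t)
    (hper : ∀ t : ℝ, x (t + T) = x t ∧ y (t + T) = y t)
    (hnonconst : ∃ t₁ t₂ : ℝ, (x t₁, y t₁) ≠ (x t₂, y t₂)) :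
    ∀ e : ℝ × ℝ, e.1 ^ 2 + e.2 ^ 2 = 1 →
      ∃! ρ : ℝ, 0 < ρ ∧ (ρ * e.1, ρ * e.2) ∈ Set.range (fun t => (x t, y t)) := by
  let c : ℝ → ℂ := fun t => Complex.equivRealProdCLM.symm (x t, y t)
  have hre : ∀ t, (c t).re = x t := fun t => Complex.equivRealProdCLM_symm_apply_re _
  have him : ∀ t, (c t).im = y t := fun t => Complex.equivRealProdCLM_symm_apply_im _
  have hV := locallyLipschitz_lienardField hlip
  have hc : ∀ t, HasDerivAt c (lienardField N f (c t)) t := fun t => by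
    rw [lienardField, hre, him]
    exact Complex.equivRealProdCLM.symm.hasFDerivAt.comp_hasDerivAt t ((hx t).prodMk (hy t))
  have hne : ∀ t, c t ≠ 0 := fun t ht => by
    have hzero := eq_of_autonomous_of_locallyLipschitz hV hc (c₂ := fun _ => 0)
      (fun t => (hasDerivAt_const t (0 : ℂ)).congr_deriv (by
        apply Complex.ext <;> simp [lienardField])) ht
    obtain ⟨t₁, t₂, h⟩ := hnonconst
    exact h (Complex.equivRealProdCLM.symm.injective
      ((congrFun hzero t₁).trans (congrFun hzero t₂).symm))
  have hrot : ∀ t, (lienardField N f (c t) / c t).im < 0 := fun t => by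
    have hneg := angular_momentum_neg (fun l hl => (hlip l hl).continuous) hL2 hL3 hT hx hy
      (fun t => (hper t).1) (fun t h => hne t (Complex.ext ((hre t).trans h.1)
        ((him t).trans h.2))) t
    rw [Complex.div_im, ← sub_div]
    refine div_neg_of_neg_of_pos ?_ (Complex.normSq_pos.2 (hne t))
    simp only [lienardField, Complex.equivRealProdCLM_symm_apply_re,
      Complex.equivRealProdCLM_symm_apply_im, hre, him]
    linarith
  intro e he
  have hmem : ∀ ρ : ℝ, (ρ * e.1, ρ * e.2) ∈ Set.range (fun t => (x t, y t)) ↔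
      (ρ : ℂ) * Complex.equivRealProdCLM.symm e ∈ Set.range c := fun ρ => by
    simp only [Set.mem_range, Prod.ext_iff, Complex.ext_iff, hre, him, Complex.re_ofReal_mul,
      Complex.im_ofReal_mul, Complex.equivRealProdCLM_symm_apply_re,
      Complex.equivRealProdCLM_symm_apply_im]
  simp only [hmem]
  refine existsUnique_radius_of_periodic_of_rotating hV hc hne hT
    (fun t => by simp only [c, hper t]) hrot ?_
  rw [← sq_eq_sq₀ (norm_nonneg _) zero_le_one, ← Complex.normSq_eq_norm_sq, Complex.normSq_apply]
  simp only [Complex.equivRealProdCLM_symm_apply_re, Complex.equivRealProdCLM_symm_apply_im]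
  linarith
end

section
/- Let N ≥ 1 and let f_1, f_3, …, f_{2N+1} : ℝ → ℝ be locally Lipschitz satisfying: (L1) there exists δ > 0 with f_1(x) < 0 for |x| < δ; (L2) f_{2l+1}(x) ≥ 0 for all x and all l ∈ {1,…,N}; (L3) each f_{2l+1} (l ∈ {0,…,N}) is monotone increasing on [0,∞) and monotone decreasing on (-∞,0]. Then any two nonconstant periodic solutions of the system x' = y, y' = -∑_{l=0}^{N} f_{2l+1}(x) y^{2l+1} - x have the same image; i.e., the system has at most one closed orbit. -/
open Set

/-- A differential inequality `w' ≥ -q w` with continuous `q` propagates the sign of `w` forward. -/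
theorem exists_pos_mul_le_of_neg_mul_le_deriv {w w' q : ℝ → ℝ} {a b : ℝ} (hab : a ≤ b)
    (hw : ∀ t, HasDerivAt w (w' t) t) (hq : Continuous q)
    (h : ∀ t ∈ Ioo a b, -q t * w t ≤ w' t) : ∃ C > 0, C * w a ≤ w b := by
  set A : ℝ → ℝ := fun t => ∫ s in a..t, q s
  have hA : ∀ t, HasDerivAt A (q t) t := fun t =>
    intervalIntegral.integral_hasDerivAt_right (hq.intervalIntegrable _ _)
      (hq.stronglyMeasurableAtFilter _ _) hq.continuousAt
  have hg : ∀ t, HasDerivAt (fun t => w t * Real.exp (A t))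
      (w' t * Real.exp (A t) + w t * (Real.exp (A t) * q t)) t := fun t =>
    (hw t).mul (hA t).exp
  have hmono : MonotoneOn (fun t => w t * Real.exp (A t)) (Icc a b) := by
    refine monotoneOn_of_deriv_nonneg (convex_Icc a b)
      (fun t _ => (hg t).continuousAt.continuousWithinAt)
      (fun t _ => (hg t).differentiableAt.differentiableWithinAt) fun t ht => ?_
    rw [interior_Icc] at ht
    rw [(hg t).deriv]
    nlinarith [h t ht, Real.exp_pos (A t)]
  have hle := hmono (left_mem_Icc.2 hab) (right_mem_Icc.2 hab) hab
  refine ⟨Real.exp (A a - A b), Real.exp_pos _, ?_⟩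
  rw [Real.exp_sub, div_mul_eq_mul_div, div_le_iff₀ (Real.exp_pos _)]
  simpa [mul_comm] using hle

/-- A periodic solution of `x' = y`, `y' = -P(x, y) y - x`. -/
structure IsPeriodicSolution (P : ℝ → ℝ → ℝ) (T : ℝ) (x y : ℝ → ℝ) : Prop where
  period_pos : 0 < T
  deriv_fst : ∀ t, HasDerivAt x (y t) t
  deriv_snd : ∀ t, HasDerivAt y (-(P (x t) (y t) * y t) - x t) t
  periodic_fst : Function.Periodic x T
  periodic_snd : Function.Periodic y T

namespace IsPeriodicSolution

variable {P : ℝ → ℝ → ℝ} {T : ℝ} {x y : ℝ → ℝ}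

theorem continuous_fst (h : IsPeriodicSolution P T x y) : Continuous x :=
  continuous_iff_continuousAt.2 fun t => (h.deriv_fst t).continuousAt

theorem continuous_snd (h : IsPeriodicSolution P T x y) : Continuous y :=
  continuous_iff_continuousAt.2 fun t => (h.deriv_snd t).continuousAt

theorem continuous_coeff (h : IsPeriodicSolution P T x y)
    (hP : Continuous fun v : ℝ × ℝ => P v.1 v.2) : Continuous fun t => P (x t) (y t) :=
  hP.comp (h.continuous_fst.prodMk h.continuous_snd)

theorem neg (h : IsPeriodicSolution P T x y) :
    IsPeriodicSolution (fun u v => P (-u) (-v)) T (fun t => -x t) (fun t => -y t) where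
  period_pos := h.period_pos
  deriv_fst t := (h.deriv_fst t).neg
  deriv_snd t := (h.deriv_snd t).neg.congr_deriv (by simp only [neg_neg]; ring)
  periodic_fst t := by simp only [h.periodic_fst t]
  periodic_snd t := by simp only [h.periodic_snd t]

theorem normSq_pos (h : IsPeriodicSolution P T x y)
    (hP : Continuous fun v : ℝ × ℝ => P v.1 v.2)
    (hne : ∃ t₁ t₂ : ℝ, (x t₁, y t₁) ≠ (x t₂, y t₂)) (t : ℝ) : 0 < x t ^ 2 + y t ^ 2 := by
  by_contra hcon
  have hvanish : ∀ s, x s ^ 2 + y s ^ 2 = 0 := by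
    intro s
    by_contra hs
    have hs_pos : 0 < x s ^ 2 + y s ^ 2 := lt_of_le_of_ne (by positivity) (Ne.symm hs)
    obtain ⟨n, hn⟩ := exists_nat_ge ((s - t) / T)
    rw [div_le_iff₀ h.period_pos] at hn
    obtain ⟨C, hC, hle⟩ := exists_pos_mul_le_of_neg_mul_le_deriv
      (w := fun t => x t ^ 2 + y t ^ 2) (q := fun t => 2 * |P (x t) (y t)|)
      (a := s - n * T) (b := t) (by linarith)
      (fun t => ((h.deriv_fst t).pow 2).add ((h.deriv_snd t).pow 2))
      ((h.continuous_coeff hP).abs.const_mul 2) (fun u _ => by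
        simp only [Nat.cast_ofNat, Nat.add_one_sub_one, pow_one]
        have h1 := le_abs_self (P (x u) (y u))
        nlinarith [mul_nonneg (sub_nonneg.2 h1) (sq_nonneg (y u)),
          mul_nonneg (abs_nonneg (P (x u) (y u))) (sq_nonneg (x u))])
    simp only [h.periodic_fst.sub_nat_mul_eq, h.periodic_snd.sub_nat_mul_eq] at hle
    exact hcon (lt_of_lt_of_le (mul_pos hC hs_pos) hle)
  have hzero : ∀ s, x s = 0 ∧ y s = 0 := fun s => by
    constructor <;> nlinarith [hvanish s, sq_nonneg (x s), sq_nonneg (y s)]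
  obtain ⟨t₁, t₂, hne⟩ := hne
  exact hne (by rw [(hzero t₁).1, (hzero t₁).2, (hzero t₂).1, (hzero t₂).2])

end IsPeriodicSolution

theorem pos_on_Ioc_of_ne_zero {g : ℝ → ℝ} (hg : Continuous g) {a b : ℝ}
    (hne : ∀ t ∈ Ioc a b, g t ≠ 0) (hb : 0 < g b) : ∀ t ∈ Ioc a b, 0 < g t := by
  intro t ht
  by_contra hcon
  obtain ⟨s, hs, hs0⟩ := intermediate_value_Icc ht.2 hg.continuousOn ⟨not_lt.1 hcon, hb.le⟩
  exact hne s ⟨ht.1.trans_le hs.1, hs.2⟩ hs0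

theorem nonneg_of_pos_on_Ioc {g : ℝ → ℝ} (hg : Continuous g) {a b : ℝ} (hab : a < b)
    (hpos : ∀ t ∈ Ioc a b, 0 < g t) : 0 ≤ g a := by
  have hmem : a ∈ closure (Ioc a b) := by
    rw [closure_Ioc hab.ne]
    exact left_mem_Icc.2 hab.le
  exact closure_minimal (fun t ht => (hpos t ht).le) (isClosed_le continuous_const hg) hmem

/-- `P` is nondecreasing along every ray from the origin. -/
def RadiallyMonotone (P : ℝ → ℝ → ℝ) : Prop :=
  ∀ k, 1 ≤ k → ∀ u v, P u v ≤ P (k * u) (k * v)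

namespace IsPeriodicSolution

variable {P : ℝ → ℝ → ℝ} {T : ℝ} {x y : ℝ → ℝ}

theorem rotation_pos_of_fst_pos (h : IsPeriodicSolution P T x y)
    (hP : Continuous fun v : ℝ × ℝ => P v.1 v.2) (hmono : RadiallyMonotone P)
    {Q : ℝ → ℝ → ℝ → ℝ} (hQ : Continuous fun v : ℝ × ℝ × ℝ => Q v.1 v.2.1 v.2.2)
    (hPQ : ∀ u v w, P u v * v - P u w * w = (v - w) * Q u v w)
    {t : ℝ} (hx : 0 < x t) :
    0 < x t ^ 2 + y t ^ 2 + P (x t) (y t) * (x t * y t) := by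
  by_contra! hcon
  have hy0 : y t ≠ 0 := by
    intro hy0
    rw [hy0] at hcon
    nlinarith
  obtain ⟨s, hs, hys⟩ := exists_hasDerivAt_eq_zero (f := x) (f' := y)
    (sub_lt_self t h.period_pos) h.continuous_fst.continuousOn
    (by rw [h.periodic_fst.sub_eq]) fun u _ => h.deriv_fst u
  have hcompact : IsCompact (Icc s t ∩ {u | x u * y u = 0}) :=
    isCompact_Icc.inter_right
      (isClosed_eq (h.continuous_fst.mul h.continuous_snd) continuous_const)
  obtain ⟨a, ⟨ha, hxya⟩, hamax⟩ := hcompact.exists_isGreatest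
    ⟨s, left_mem_Icc.2 hs.2.le, by simp [hys]⟩
  simp only [mem_ofPred_eq] at hxya
  have hat : a < t := lt_of_le_of_ne ha.2 (by rintro rfl; simp [hx.ne', hy0] at hxya)
  have hxy_ne : ∀ u ∈ Ioc a t, x u * y u ≠ 0 := fun u hu h0 =>
    absurd (hamax ⟨⟨ha.1.trans hu.1.le, hu.2⟩, h0⟩) (not_le.2 hu.1)
  have hx_pos := pos_on_Ioc_of_ne_zero h.continuous_fst
    (fun u hu => left_ne_zero_of_mul (hxy_ne u hu)) hx
  have hxa := nonneg_of_pos_on_Ioc h.continuous_fst hat hx_pos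
  set c := y t / x t with hc
  have hyc : y t = c * x t := by rw [hc]; field_simp
  have hcrit : 1 + c ^ 2 + c * P (x t) (c * x t) ≤ 0 := by
    rw [hyc] at hcon
    by_contra! hpos
    nlinarith [mul_pos hpos (pow_pos hx 2)]
  suffices hmain : (∀ u ∈ Ioo a t, c * P (x u) (c * x u) ≤ c * P (x t) (c * x t)) ∧
      0 < y a - c * x a by
    obtain ⟨hcmp, hwa⟩ := hmain
    obtain ⟨C, hC, hle⟩ := exists_pos_mul_le_of_neg_mul_le_deriv (w := fun u => y u - c * x u)
      (q := fun u => Q (x u) (y u) (c * x u) + c) hat.le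
      (fun u => (h.deriv_snd u).sub ((h.deriv_fst u).const_mul c))
      ((hQ.comp (h.continuous_fst.prodMk
        (h.continuous_snd.prodMk (h.continuous_fst.const_mul c)))).add continuous_const)
      (fun u hu => by
        have h1 := hPQ (x u) (y u) (c * x u)
        have h2 := hx_pos u ⟨hu.1, hu.2.le⟩
        nlinarith [mul_nonneg h2.le (by linarith [hcmp u hu, hcrit] :
          0 ≤ -(1 + c ^ 2 + c * P (x u) (c * x u)))])
    simp only [← hyc, sub_self] at hle
    nlinarith [mul_pos hC hwa]
  rcases lt_or_gt_of_ne hy0 with hy | hy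
  · have hc_neg : c < 0 := div_neg_of_neg_of_pos hy hx
    have hy_neg : ∀ u ∈ Ioc a t, 0 < -y u := pos_on_Ioc_of_ne_zero h.continuous_snd.neg
      (fun u hu => neg_ne_zero.2 (right_ne_zero_of_mul (hxy_ne u hu))) (neg_pos.2 hy)
    have hanti : AntitoneOn x (Icc a t) :=
      antitoneOn_of_deriv_nonpos (convex_Icc a t) h.continuous_fst.continuousOn
        (fun u _ => (h.deriv_fst u).differentiableAt.differentiableWithinAt) fun u hu => by
          rw [interior_Icc] at hu
          rw [(h.deriv_fst u).deriv]
          linarith [hy_neg u ⟨hu.1, hu.2.le⟩]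
    have hxa_pos : 0 < x a :=
      hx.trans_le (hanti (left_mem_Icc.2 hat.le) (right_mem_Icc.2 hat.le) hat.le)
    have hya : y a = 0 := (mul_eq_zero.1 hxya).resolve_left hxa_pos.ne'
    refine ⟨fun u hu => mul_le_mul_of_nonpos_left ?_ hc_neg.le, by rw [hya]; nlinarith⟩
    have hle := hanti ⟨hu.1.le, hu.2.le⟩ (right_mem_Icc.2 hat.le) hu.2.le
    have h1 := hmono (x u / x t) ((one_le_div hx).2 hle) (x t) (c * x t)
    rwa [mul_left_comm, div_mul_cancel₀ (x u) hx.ne'] at h1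
  · have hc_pos : 0 < c := div_pos hy hx
    have hy_pos := pos_on_Ioc_of_ne_zero h.continuous_snd
      (fun u hu => right_ne_zero_of_mul (hxy_ne u hu)) hy
    have hya := nonneg_of_pos_on_Ioc h.continuous_snd hat hy_pos
    have hmonoOn : MonotoneOn x (Icc a t) :=
      monotoneOn_of_deriv_nonneg (convex_Icc a t) h.continuous_fst.continuousOn
        (fun u _ => (h.deriv_fst u).differentiableAt.differentiableWithinAt) fun u hu => by
          rw [interior_Icc] at hu
          rw [(h.deriv_fst u).deriv]
          exact (hy_pos u ⟨hu.1, hu.2.le⟩).le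
    have hya_ne : y a ≠ 0 := by
      intro hya0
      obtain ⟨C, hC, hle⟩ := exists_pos_mul_le_of_neg_mul_le_deriv (w := fun u => -y u)
        (q := fun u => P (x u) (y u)) hat.le (fun u => (h.deriv_snd u).neg)
        (h.continuous_coeff hP) fun u hu => by
          linarith [hx_pos u ⟨hu.1, hu.2.le⟩]
      simp only [hya0] at hle
      linarith
    have hxa0 : x a = 0 := (mul_eq_zero.1 hxya).resolve_right hya_ne
    refine ⟨fun u hu => mul_le_mul_of_nonneg_left ?_ hc_pos.le, by
      rw [hxa0, mul_zero, sub_zero]; exact lt_of_le_of_ne hya hya_ne.symm⟩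
    have hxu := hx_pos u ⟨hu.1, hu.2.le⟩
    have hle := hmonoOn ⟨hu.1.le, hu.2.le⟩ (right_mem_Icc.2 hat.le) hu.2.le
    have h1 := hmono (x t / x u) ((one_le_div hxu).2 hle) (x u) (c * x u)
    rwa [mul_left_comm, div_mul_cancel₀ (x t) hxu.ne'] at h1

/-- A nonconstant periodic solution rotates strictly clockwise around the origin. -/
theorem rotation_pos (h : IsPeriodicSolution P T x y)
    (hP : Continuous fun v : ℝ × ℝ => P v.1 v.2) (hmono : RadiallyMonotone P)
    {Q : ℝ → ℝ → ℝ → ℝ} (hQ : Continuous fun v : ℝ × ℝ × ℝ => Q v.1 v.2.1 v.2.2)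
    (hPQ : ∀ u v w, P u v * v - P u w * w = (v - w) * Q u v w)
    (hne : ∀ t, 0 < x t ^ 2 + y t ^ 2) (t : ℝ) :
    0 < x t ^ 2 + y t ^ 2 + P (x t) (y t) * (x t * y t) := by
  rcases lt_trichotomy (x t) 0 with hx | hx | hx
  · have h1 := h.neg.rotation_pos_of_fst_pos (Q := fun u v w => Q (-u) (-v) (-w)) (t := t)
      (by fun_prop) (fun k hk u v => by simpa using hmono k hk (-u) (-v)) (by fun_prop)
      (fun u v w => by linarith [hPQ (-u) (-v) (-w)]) (by simpa using hx)
    simpa using h1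
  · have h1 := hne t
    rw [hx] at h1 ⊢
    linarith
  · exact h.rotation_pos_of_fst_pos hP hmono hQ hPQ hx

end IsPeriodicSolution

open Real in
/-- A `2πn`-periodic function `Z` whose curve `e^Z (cos θ, -sin θ)` is an orbit of
`x' = y`, `y' = -P(x, y) y - x` parametrized by its clockwise angle. -/
structure IsPolarOrbit (P : ℝ → ℝ → ℝ) (n : ℕ) (Z : ℝ → ℝ) : Prop where
  pos : 0 < n
  periodic : Function.Periodic Z (n * (2 * π))
  rotation_pos : ∀ θ, 0 < 1 - P (exp (Z θ) * cos θ) (-(exp (Z θ) * sin θ)) * (cos θ * sin θ)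
  hasDerivAt : ∀ θ, HasDerivAt Z
    (-(P (exp (Z θ) * cos θ) (-(exp (Z θ) * sin θ)) * sin θ ^ 2) /
      (1 - P (exp (Z θ) * cos θ) (-(exp (Z θ) * sin θ)) * (cos θ * sin θ))) θ

/-- A continuous function has an antiderivative with prescribed value at `0`. -/
theorem exists_hasDerivAt_of_continuous {q : ℝ → ℝ} (hq : Continuous q) (c : ℝ) :
    ∃ A : ℝ → ℝ, A 0 = c ∧ ∀ t, HasDerivAt A (q t) t := by
  refine ⟨fun t => c + ∫ s in (0 : ℝ)..t, q s, by simp, fun t => ?_⟩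
  exact (intervalIntegral.integral_hasDerivAt_right (hq.intervalIntegrable _ _)
    (hq.stronglyMeasurableAtFilter _ _) hq.continuousAt).const_add c

/-- Continuous polar coordinates (logarithm of the radius, clockwise angle) along a curve
that avoids the origin. -/
theorem exists_polar_lift {x y x' y' : ℝ → ℝ} (hx : ∀ t, HasDerivAt x (x' t) t)
    (hy : ∀ t, HasDerivAt y (y' t) t) (hx' : Continuous x') (hy' : Continuous y')
    (hne : ∀ t, 0 < x t ^ 2 + y t ^ 2) :
    ∃ R Θ : ℝ → ℝ,
      (∀ t, HasDerivAt R ((x t * x' t + y t * y' t) / (x t ^ 2 + y t ^ 2)) t) ∧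
      (∀ t, HasDerivAt Θ ((y t * x' t - x t * y' t) / (x t ^ 2 + y t ^ 2)) t) ∧
      (∀ t, x t = Real.exp (R t) * Real.cos (Θ t)) ∧
      ∀ t, y t = -(Real.exp (R t) * Real.sin (Θ t)) := by
  have hxc : Continuous x := continuous_iff_continuousAt.2 fun t => (hx t).continuousAt
  have hyc : Continuous y := continuous_iff_continuousAt.2 fun t => (hy t).continuousAt
  set z₀ : ℂ := ⟨x 0, y 0⟩
  have hz₀_ne : z₀ ≠ 0 := by
    intro h0
    have h1 : x 0 = 0 := congrArg Complex.re h0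
    have h2 : y 0 = 0 := congrArg Complex.im h0
    have := hne 0
    simp [h1, h2] at this
  obtain ⟨R, hR0, hR⟩ := exists_hasDerivAt_of_continuous
    (q := fun t => (x t * x' t + y t * y' t) / (x t ^ 2 + y t ^ 2))
    (Continuous.div (by fun_prop) (by fun_prop) fun t => (hne t).ne') (Real.log ‖z₀‖)
  obtain ⟨Θ, hΘ0, hΘ⟩ := exists_hasDerivAt_of_continuous
    (q := fun t => (y t * x' t - x t * y' t) / (x t ^ 2 + y t ^ 2))
    (Continuous.div (by fun_prop) (by fun_prop) fun t => (hne t).ne') (-Complex.arg z₀)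
  -- `(x + i y) e^{-R + iΘ}` is constant, split into real and imaginary parts.
  have hre : ∀ t, HasDerivAt
      (fun t => Real.exp (-R t) * (x t * Real.cos (Θ t) - y t * Real.sin (Θ t))) 0 t := by
    intro t
    refine ((hR t).neg.exp.mul (((hx t).mul (hΘ t).cos).sub ((hy t).mul (hΘ t).sin))).congr_deriv ?_
    have := (hne t).ne'
    simp only [Pi.mul_apply, Pi.sub_apply, Pi.neg_apply]
    field_simp
    ring
  have him : ∀ t, HasDerivAt
      (fun t => Real.exp (-R t) * (x t * Real.sin (Θ t) + y t * Real.cos (Θ t))) 0 t := by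
    intro t
    refine ((hR t).neg.exp.mul (((hx t).mul (hΘ t).sin).add ((hy t).mul (hΘ t).cos))).congr_deriv ?_
    have := (hne t).ne'
    simp only [Pi.mul_apply, Pi.add_apply, Pi.neg_apply]
    field_simp
    ring
  have hexp0 : Real.exp (R 0) = ‖z₀‖ := by rw [hR0, Real.exp_log (norm_pos_iff.2 hz₀_ne)]
  have hx0 : x 0 = Real.exp (R 0) * Real.cos (Θ 0) := by
    rw [hexp0, hΘ0, Real.cos_neg, Complex.norm_mul_cos_arg]
  have hy0 : y 0 = -(Real.exp (R 0) * Real.sin (Θ 0)) := by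
    rw [hexp0, hΘ0, Real.sin_neg, mul_neg, neg_neg, Complex.norm_mul_sin_arg]
  have hre_eq : ∀ t, x t * Real.cos (Θ t) - y t * Real.sin (Θ t) = Real.exp (R t) := by
    intro t
    have h1 := is_const_of_deriv_eq_zero (fun t => (hre t).differentiableAt)
      (fun t => (hre t).deriv) t 0
    simp only [Real.exp_neg] at h1
    rw [hx0, hy0] at h1
    have h2 := Real.exp_pos (R t)
    have h3 := Real.exp_pos (R 0)
    field_simp at h1
    linear_combination h1 + Real.exp (R t) * Real.sin_sq_add_cos_sq (Θ 0)
  have him_eq : ∀ t, x t * Real.sin (Θ t) + y t * Real.cos (Θ t) = 0 := by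
    intro t
    have h1 := is_const_of_deriv_eq_zero (fun t => (him t).differentiableAt)
      (fun t => (him t).deriv) t 0
    beta_reduce at h1
    rw [hx0, hy0] at h1
    have h2 : Real.exp (-R t) * (x t * Real.sin (Θ t) + y t * Real.cos (Θ t)) = 0 := by
      rw [h1]; ring
    exact (mul_eq_zero.1 h2).resolve_left (Real.exp_pos _).ne'
  refine ⟨R, Θ, hR, hΘ, fun t => ?_, fun t => ?_⟩
  · linear_combination Real.cos (Θ t) * hre_eq t + Real.sin (Θ t) * him_eq t
      - x t * Real.sin_sq_add_cos_sq (Θ t)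
  · linear_combination -Real.sin (Θ t) * hre_eq t + Real.cos (Θ t) * him_eq t
      - y t * Real.sin_sq_add_cos_sq (Θ t)

/-- A continuous function that increases by `c > 0` over each time span `T` is surjective. -/
theorem surjective_of_add_eq_add {Θ : ℝ → ℝ} (hΘ : Continuous Θ) {T c : ℝ} (hc : 0 < c)
    (h : ∀ t, Θ (t + T) = Θ t + c) : Function.Surjective Θ := by
  have hnat : ∀ (m : ℕ) t, Θ (t + m * T) = Θ t + m * c := by
    intro m
    induction m with
    | zero => simp
    | succ k ih =>
      intro t
      have h1 := h (t + k * T)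
      rw [ih] at h1
      push_cast
      rw [add_one_mul, ← add_assoc, h1]
      ring
  intro θ
  obtain ⟨m, hm⟩ := exists_nat_ge (|θ - Θ 0| / c)
  rw [div_le_iff₀ hc] at hm
  have h1 := hnat m 0
  have h2 := hnat m (0 - m * T)
  rw [sub_add_cancel] at h2
  have h3 := abs_le.1 hm
  exact mem_range_of_exists_le_of_exists_ge hΘ ⟨0 - m * T, by linarith⟩ ⟨0 + m * T, by linarith⟩

namespace IsPeriodicSolution

variable {P : ℝ → ℝ → ℝ} {T : ℝ} {x y : ℝ → ℝ}

theorem exists_polarOrbit (h : IsPeriodicSolution P T x y)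
    (hP : Continuous fun v : ℝ × ℝ => P v.1 v.2) (hne : ∀ t, 0 < x t ^ 2 + y t ^ 2)
    (hrot : ∀ t, 0 < x t ^ 2 + y t ^ 2 + P (x t) (y t) * (x t * y t)) :
    ∃ n Z, IsPolarOrbit P n Z ∧ range (fun t => (x t, y t)) =
      range fun θ => (Real.exp (Z θ) * Real.cos θ, -(Real.exp (Z θ) * Real.sin θ)) := by
  have hcoeff := h.continuous_coeff hP
  have hxc := h.continuous_fst
  have hyc := h.continuous_snd
  obtain ⟨R, Θ, hR, hΘ, hx, hy⟩ := exists_polar_lift h.deriv_fst h.deriv_snd hyc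
    (by fun_prop) hne
  have hω : ∀ t, 0 < (y t * y t - x t * (-(P (x t) (y t) * y t) - x t)) /
      (x t ^ 2 + y t ^ 2) := fun t => div_pos (by linarith [hrot t]) (hne t)
  have hΘ_mono : StrictMono Θ := strictMono_of_deriv_pos fun t => by
    rw [(hΘ t).deriv]; exact hω t
  have hΘ_cont : Continuous Θ := continuous_iff_continuousAt.2 fun t => (hΘ t).continuousAt
  have hsq : ∀ t, x t ^ 2 + y t ^ 2 = Real.exp (R t) ^ 2 := fun t => by
    rw [hx, hy]
    linear_combination Real.exp (R t) ^ 2 * Real.sin_sq_add_cos_sq (Θ t)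
  have hR_per : Function.Periodic R T := fun t => by
    have h1 := hsq (t + T)
    rw [h.periodic_fst, h.periodic_snd, hsq t] at h1
    exact (Real.exp_injective ((sq_eq_sq₀ (Real.exp_pos _).le (Real.exp_pos _).le).1 h1)).symm
  obtain ⟨n, hn_pos, hn⟩ : ∃ n : ℕ, 0 < n ∧ Θ T = Θ 0 + n * (2 * Real.pi) := by
    have hcos : Real.cos (Θ T) = Real.cos (Θ 0) := by
      have h1 := h.periodic_fst 0
      rw [zero_add, hx, hx, ← zero_add T, hR_per 0, zero_add] at h1
      exact mul_left_cancel₀ (Real.exp_pos _).ne' h1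
    have hsin : Real.sin (Θ T) = Real.sin (Θ 0) := by
      have h1 := h.periodic_snd 0
      rw [zero_add, hy, hy, ← zero_add T, hR_per 0, zero_add] at h1
      exact mul_left_cancel₀ (Real.exp_pos _).ne' (neg_injective h1)
    obtain ⟨m, hm⟩ := Real.Angle.angle_eq_iff_two_pi_dvd_sub.1 (Real.Angle.cos_sin_inj hcos hsin)
    have hlt := hΘ_mono h.period_pos
    have hm_pos : 0 < m := by
      have : 0 < 2 * Real.pi * (m : ℝ) := by linarith
      exact_mod_cast pos_of_mul_pos_right this (by positivity)
    lift m to ℕ using hm_pos.le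
    refine ⟨m, by exact_mod_cast hm_pos, ?_⟩
    push_cast at hm
    linarith
  have hΘ_add : ∀ t, Θ (t + T) = Θ t + n * (2 * Real.pi) := by
    have hd : ∀ t, HasDerivAt (fun t => Θ (t + T) - Θ t) 0 t := fun t => by
      refine (((hΘ (t + T)).comp_add_const t T).sub (hΘ t)).congr_deriv ?_
      rw [h.periodic_fst, h.periodic_snd, sub_self]
    intro t
    have h1 := is_const_of_deriv_eq_zero (fun t => (hd t).differentiableAt)
      (fun t => (hd t).deriv) t 0
    simp only [zero_add] at h1
    linarith
  have hsurj := surjective_of_add_eq_add hΘ_cont (by positivity) hΘ_add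
  set e := hΘ_mono.orderIsoOfSurjective Θ hsurj
  have hΘe : ∀ θ, Θ (e.symm θ) = θ :=
    hΘ_mono.orderIsoOfSurjective_self_symm_apply Θ hsurj
  have heΘ : ∀ t, e.symm (Θ t) = t :=
    hΘ_mono.orderIsoOfSurjective_symm_apply_self Θ hsurj
  have hxe : ∀ θ, x (e.symm θ) = Real.exp (R (e.symm θ)) * Real.cos θ := fun θ => by
    rw [hx, hΘe]
  have hye : ∀ θ, y (e.symm θ) = -(Real.exp (R (e.symm θ)) * Real.sin θ) := fun θ => by
    rw [hy, hΘe]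
  have hrot_eq : ∀ θ, (y (e.symm θ) * y (e.symm θ) - x (e.symm θ) *
      (-(P (x (e.symm θ)) (y (e.symm θ)) * y (e.symm θ)) - x (e.symm θ))) /
      (x (e.symm θ) ^ 2 + y (e.symm θ) ^ 2) =
      1 - P (x (e.symm θ)) (y (e.symm θ)) * (Real.cos θ * Real.sin θ) := fun θ => by
    rw [hsq, div_eq_iff (by positivity)]
    generalize P (x (e.symm θ)) (y (e.symm θ)) = p
    rw [hxe, hye]
    linear_combination Real.exp (R (e.symm θ)) ^ 2 * Real.sin_sq_add_cos_sq θ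
  refine ⟨n, fun θ => R (e.symm θ), ⟨hn_pos, fun θ => ?_, fun θ => ?_, fun θ => ?_⟩, ?_⟩
  · have h1 : e.symm (θ + n * (2 * Real.pi)) = e.symm θ + T :=
      hΘ_mono.injective (by rw [hΘe, hΘ_add, hΘe])
    simp only [h1, hR_per _]
  · rw [← hxe, ← hye, ← hrot_eq]
    exact hω _
  · have he_deriv := HasDerivAt.of_local_left_inverse e.symm.continuous.continuousAt
      (hΘ (e.symm θ)) (hω _).ne' (Filter.Eventually.of_forall hΘe)
    refine ((hR (e.symm θ)).comp θ he_deriv).congr_deriv ?_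
    rw [← hxe, ← hye, hrot_eq, ← div_eq_mul_inv]
    congr 1
    rw [hsq, div_eq_iff (by positivity)]
    generalize P (x (e.symm θ)) (y (e.symm θ)) = p
    rw [hxe, hye]
    ring
  · ext v
    constructor
    · rintro ⟨t, rfl⟩
      exact ⟨Θ t, by simp only [heΘ, ← hx, ← hy]⟩
    · rintro ⟨θ, rfl⟩
      exact ⟨e.symm θ, by simp only [hxe, hye]⟩

end IsPeriodicSolution

theorem Antitone.eq_of_periodic {g : ℝ → ℝ} (hg : Antitone g) {c : ℝ} (hc : 0 < c)
    (hper : Function.Periodic g c) (a b : ℝ) : g a = g b := by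
  have hle : ∀ a b, g a ≤ g b := fun a b => by
    obtain ⟨n, hn⟩ := exists_nat_ge ((b - a) / c)
    rw [div_le_iff₀ hc] at hn
    rw [← hper.nat_mul n a]
    exact hg (by linarith)
  exact le_antisymm (hle a b) (hle b a)

namespace IsPolarOrbit

variable {P : ℝ → ℝ → ℝ} {n m : ℕ} {Z W : ℝ → ℝ}

theorem exists_eq_add (hmono : RadiallyMonotone P) (hZ : IsPolarOrbit P n Z)
    (hW : IsPolarOrbit P m W) : ∃ d, ∀ θ, Z θ = W θ + d := by
  have hcmp : ∀ {n m : ℕ} {Z W : ℝ → ℝ}, IsPolarOrbit P n Z → IsPolarOrbit P m W →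
      ∀ θ, W θ ≤ Z θ → deriv Z θ ≤ deriv W θ := by
    intro n m Z W hZ hW θ hle
    have h1 := hmono (Real.exp (Z θ - W θ)) (Real.one_le_exp (sub_nonneg.2 hle))
      (Real.exp (W θ) * Real.cos θ) (-(Real.exp (W θ) * Real.sin θ))
    rw [mul_neg, ← mul_assoc, ← mul_assoc, ← Real.exp_add, sub_add_cancel] at h1
    rw [(hZ.hasDerivAt θ).deriv, (hW.hasDerivAt θ).deriv,
      div_le_div_iff₀ (hZ.rotation_pos θ) (hW.rotation_pos θ)]
    nlinarith [mul_nonneg (sub_nonneg.2 h1) (sq_nonneg (Real.sin θ))]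
  have hD : ∀ θ, HasDerivAt (fun θ => Z θ - W θ) (deriv Z θ - deriv W θ) θ := fun θ =>
    (hZ.hasDerivAt θ).differentiableAt.hasDerivAt.sub
      (hW.hasDerivAt θ).differentiableAt.hasDerivAt
  have hDsq : ∀ θ, HasDerivAt (fun θ => (Z θ - W θ) ^ 2)
      (2 * (Z θ - W θ) * (deriv Z θ - deriv W θ)) θ := fun θ => by
    exact ((hD θ).pow 2).congr_deriv (by norm_num)
  have hanti : Antitone fun θ => (Z θ - W θ) ^ 2 := by
    refine antitone_of_deriv_nonpos (fun θ => (hDsq θ).differentiableAt) fun θ => ?_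
    rw [(hDsq θ).deriv]
    rcases le_total (W θ) (Z θ) with hle | hle
    · nlinarith [mul_nonneg (sub_nonneg.2 hle) (sub_nonneg.2 (hcmp hZ hW θ hle))]
    · nlinarith [mul_nonneg (sub_nonneg.2 hle) (sub_nonneg.2 (hcmp hW hZ θ hle))]
  have hper : Function.Periodic (fun θ => (Z θ - W θ) ^ 2) (m * (n * (2 * Real.pi))) := by
    have h1 := hZ.periodic.nat_mul m
    have h2 := hW.periodic.nat_mul n
    intro θ
    have h3 := h2 θ
    rw [mul_left_comm] at h3
    simp only [h1 θ, h3]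
  have hconst := hanti.eq_of_periodic (by have := hZ.pos; have := hW.pos; positivity) hper
  refine ⟨Z 0 - W 0, fun θ => ?_⟩
  have hD0 : ∀ θ, deriv (fun θ => Z θ - W θ) θ = 0 := fun θ => by
    rw [(hD θ).deriv]
    by_cases h0 : Z θ - W θ = 0
    · have hzero : ∀ u, Z u - W u = 0 := fun u => by
        have h1 := hconst u θ
        simp only [h0] at h1
        simpa using h1
      have h2 := hD θ
      simp only [hzero] at h2
      exact h2.unique (hasDerivAt_const θ 0)
    · have h1 : (fun θ => (Z θ - W θ) ^ 2) = fun _ => (Z θ - W θ) ^ 2 :=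
        funext fun u => hconst u θ
      have h2 := hDsq θ
      rw [h1] at h2
      have h3 := h2.unique (hasDerivAt_const θ _)
      exact (mul_eq_zero.1 h3).resolve_left (mul_ne_zero two_ne_zero h0)
  have h1 := is_const_of_deriv_eq_zero (fun θ => (hD θ).differentiableAt) hD0 θ 0
  beta_reduce at h1
  linarith

theorem coeff_eq_of_eq_add (hZ : IsPolarOrbit P n Z) (hW : IsPolarOrbit P m W) {d : ℝ}
    (hd : ∀ θ, Z θ = W θ + d) {θ : ℝ} (hθ : Real.sin θ ≠ 0) :
    P (Real.exp (Z θ) * Real.cos θ) (-(Real.exp (Z θ) * Real.sin θ)) =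
      P (Real.exp (W θ) * Real.cos θ) (-(Real.exp (W θ) * Real.sin θ)) := by
  have h1 := hZ.hasDerivAt θ
  rw [show Z = fun θ => W θ + d from funext hd] at h1
  have h2 := h1.unique ((hW.hasDerivAt θ).add_const d)
  have h3 := hZ.rotation_pos θ
  rw [show Z = fun θ => W θ + d from funext hd] at h3 ⊢
  rw [div_eq_div_iff h3.ne' (hW.rotation_pos θ).ne'] at h2
  apply mul_right_cancel₀ (pow_ne_zero 2 hθ)
  linear_combination -h2

/-- The damping cannot be negative along a whole periodic orbit. -/
theorem exists_coeff_nonneg (hZ : IsPolarOrbit P n Z) :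
    ∃ θ, Real.sin θ ≠ 0 ∧
      0 ≤ P (Real.exp (Z θ) * Real.cos θ) (-(Real.exp (Z θ) * Real.sin θ)) := by
  by_contra! hneg
  have hanti : Antitone fun θ => -Z θ :=
    antitone_of_deriv_nonpos (fun θ => (hZ.hasDerivAt θ).neg.differentiableAt) fun θ => by
      rw [deriv.fun_neg, neg_nonpos, (hZ.hasDerivAt θ).deriv]
      refine div_nonneg ?_ (hZ.rotation_pos θ).le
      by_cases hθ : Real.sin θ = 0
      · simp [hθ]
      · nlinarith [hneg θ hθ, sq_nonneg (Real.sin θ)]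
  have hconst := hanti.eq_of_periodic (by have := hZ.pos; positivity)
    (fun θ => congrArg Neg.neg (hZ.periodic θ))
  have h0 : Z = fun _ => Z 0 := funext fun θ => neg_injective (hconst θ 0)
  have h1 := hZ.hasDerivAt (Real.pi / 2)
  have h2 : HasDerivAt Z 0 (Real.pi / 2) := by
    rw [h0]
    exact hasDerivAt_const _ _
  have h3 := h1.unique h2
  have h4 := hneg (Real.pi / 2) (by simp)
  simp only [Real.sin_pi_div_two, Real.cos_pi_div_two] at h3 h4
  simp only [mul_zero, mul_one, sub_zero, one_pow, div_one] at h3 h4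
  linarith

end IsPolarOrbit

/-- The coefficient `∑_{l ≤ N} f_l(x) y^(2l)` of the damping force `P(x, y) y`. -/
def dampingCoeff (N : ℕ) (f : ℕ → ℝ → ℝ) (x y : ℝ) : ℝ :=
  ∑ l ∈ Finset.range (N + 1), f l x * y ^ (2 * l)

section dampingCoeff

variable {N : ℕ} {f : ℕ → ℝ → ℝ}

theorem dampingCoeff_mul (x y : ℝ) :
    dampingCoeff N f x y * y = ∑ l ∈ Finset.range (N + 1), f l x * y ^ (2 * l + 1) := by
  simp only [dampingCoeff, Finset.sum_mul, pow_succ, mul_assoc]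

theorem continuous_dampingCoeff (hf : ∀ l ≤ N, Continuous (f l)) :
    Continuous fun v : ℝ × ℝ => dampingCoeff N f v.1 v.2 := by
  refine continuous_finsetSum _ fun l hl => ?_
  have := hf l (Nat.lt_succ_iff.1 (Finset.mem_range.1 hl))
  fun_prop

theorem exists_continuous_dampingCoeff_mul_sub (hf : ∀ l ≤ N, Continuous (f l)) :
    ∃ Q : ℝ → ℝ → ℝ → ℝ, (Continuous fun v : ℝ × ℝ × ℝ => Q v.1 v.2.1 v.2.2) ∧
      ∀ x y z, dampingCoeff N f x y * y - dampingCoeff N f x z * z = (y - z) * Q x y z := by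
  refine ⟨fun x y z => ∑ l ∈ Finset.range (N + 1), f l x *
    ∑ i ∈ Finset.range (2 * l + 1), y ^ i * z ^ (2 * l + 1 - 1 - i), ?_, fun x y z => ?_⟩
  · refine continuous_finsetSum _ fun l hl => ?_
    have := hf l (Nat.lt_succ_iff.1 (Finset.mem_range.1 hl))
    fun_prop
  · rw [dampingCoeff_mul, dampingCoeff_mul, ← Finset.sum_sub_distrib, Finset.mul_sum]
    refine Finset.sum_congr rfl fun l _ => ?_
    rw [← mul_sub, ← geom_sum₂_mul]
    ring

theorem le_apply_mul {g : ℝ → ℝ} (hg : MonotoneOn g (Ici 0) ∧ AntitoneOn g (Iic 0)) {k : ℝ}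
    (hk : 1 ≤ k) (u : ℝ) : g u ≤ g (k * u) := by
  rcases le_total 0 u with hu | hu
  · exact hg.1 hu (mul_nonneg (by linarith) hu) (by nlinarith)
  · exact hg.2 (mul_nonpos_of_nonneg_of_nonpos (by linarith) hu) hu (by nlinarith)

theorem le_apply_mul_mul_pow (hL2 : ∀ l, 1 ≤ l → l ≤ N → ∀ x : ℝ, 0 ≤ f l x)
    (hL3 : ∀ l ≤ N, MonotoneOn (f l) (Ici 0) ∧ AntitoneOn (f l) (Iic 0)) {k : ℝ} (hk : 1 ≤ k)
    {l : ℕ} (hl : l ≤ N) (u : ℝ) : f l u ≤ f l (k * u) * k ^ (2 * l) := by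
  rcases Nat.eq_zero_or_pos l with rfl | hpos
  · simpa using le_apply_mul (hL3 0 hl) hk u
  · exact (le_apply_mul (hL3 l hl) hk u).trans
      (le_mul_of_one_le_right (hL2 l hpos hl _) (one_le_pow₀ hk))

theorem radiallyMonotone_dampingCoeff (hL2 : ∀ l, 1 ≤ l → l ≤ N → ∀ x : ℝ, 0 ≤ f l x)
    (hL3 : ∀ l ≤ N, MonotoneOn (f l) (Ici 0) ∧ AntitoneOn (f l) (Iic 0)) :
    RadiallyMonotone (dampingCoeff N f) := by
  intro k hk u v
  refine Finset.sum_le_sum fun l hl => ?_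
  rw [mul_pow, ← mul_assoc]
  exact mul_le_mul_of_nonneg_right
    (le_apply_mul_mul_pow hL2 hL3 hk (Nat.lt_succ_iff.1 (Finset.mem_range.1 hl)) u)
    ((even_two_mul l).pow_nonneg v)

/-- Equality in radial monotonicity of the damping coefficient holds termwise. -/
theorem eq_apply_mul_mul_pow_of_dampingCoeff_eq
    (hL2 : ∀ l, 1 ≤ l → l ≤ N → ∀ x : ℝ, 0 ≤ f l x)
    (hL3 : ∀ l ≤ N, MonotoneOn (f l) (Ici 0) ∧ AntitoneOn (f l) (Iic 0)) {k : ℝ} (hk : 1 ≤ k)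
    {u v : ℝ} (hv : v ≠ 0) (heq : dampingCoeff N f (k * u) (k * v) = dampingCoeff N f u v)
    {l : ℕ} (hl : l ≤ N) : f l u = f l (k * u) * k ^ (2 * l) := by
  have hterm := (Finset.sum_eq_sum_iff_of_le (s := Finset.range (N + 1))
    (f := fun l => f l u * v ^ (2 * l)) (g := fun l => f l (k * u) * (k * v) ^ (2 * l))
    fun l hl => by
      rw [mul_pow, ← mul_assoc]
      exact mul_le_mul_of_nonneg_right
        (le_apply_mul_mul_pow hL2 hL3 hk (Nat.lt_succ_iff.1 (Finset.mem_range.1 hl)) u)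
        ((even_two_mul l).pow_nonneg v)).1 heq.symm l (Finset.mem_range.2 (Nat.lt_succ_of_le hl))
  simp only [mul_pow, ← mul_assoc] at hterm
  exact mul_right_cancel₀ (pow_ne_zero _ hv) hterm

theorem dampingCoeff_not_homothetic (hL1 : ∃ δ > 0, ∀ x : ℝ, |x| < δ → f 0 x < 0)
    (hL2 : ∀ l, 1 ≤ l → l ≤ N → ∀ x : ℝ, 0 ≤ f l x)
    (hL3 : ∀ l ≤ N, MonotoneOn (f l) (Ici 0) ∧ AntitoneOn (f l) (Iic 0))
    {n m : ℕ} {Z W : ℝ → ℝ} (hZ : IsPolarOrbit (dampingCoeff N f) n Z)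
    (hW : IsPolarOrbit (dampingCoeff N f) m W) {d : ℝ} (hd : ∀ θ, Z θ = W θ + d) : d ≤ 0 := by
  by_contra! hd_pos
  set k := Real.exp d
  have hk_one : 1 < k := Real.one_lt_exp_iff.2 hd_pos
  set X : ℝ → ℝ := fun θ => Real.exp (W θ) * Real.cos θ with hX
  have hterm : ∀ θ, Real.sin θ ≠ 0 → ∀ l ≤ N, f l (X θ) = f l (k * X θ) * k ^ (2 * l) := by
    intro θ hθ l hl
    have h1 := hZ.coeff_eq_of_eq_add hW hd hθ
    rw [hd θ, Real.exp_add, mul_comm (Real.exp (W θ)), mul_assoc, mul_assoc, ← mul_neg] at h1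
    exact eq_apply_mul_mul_pow_of_dampingCoeff_eq hL2 hL3 hk_one.le
      (neg_ne_zero.2 (mul_ne_zero (Real.exp_pos _).ne' hθ)) h1 hl
  have hhigher : ∀ θ, Real.sin θ ≠ 0 → ∀ l, 1 ≤ l → l ≤ N → f l (X θ) = 0 := by
    intro θ hθ l hl hlN
    have h1 := hterm θ hθ l hlN
    have h2 := le_apply_mul (hL3 l hlN) hk_one.le (X θ)
    have h3 := hL2 l hl hlN (X θ)
    have h4 : 1 < k ^ (2 * l) := one_lt_pow₀ hk_one (by omega)
    nlinarith
  have hlowest : ∀ θ, Real.sin θ ≠ 0 → f 0 (X θ) < 0 := by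
    intro θ hθ
    set j := ⌊θ / Real.pi⌋
    set J := Ioo (j * Real.pi) ((j + 1) * Real.pi)
    have hJ_sin : ∀ u ∈ J, Real.sin u ≠ 0 := by
      intro u hu h0
      obtain ⟨i, rfl⟩ := Real.sin_eq_zero_iff.1 h0
      have h1 := lt_of_mul_lt_mul_right hu.1 Real.pi_pos.le
      have h2 := lt_of_mul_lt_mul_right hu.2 Real.pi_pos.le
      norm_cast at h1 h2
      omega
    have hθJ : θ ∈ J := by
      refine ⟨lt_of_le_of_ne ((le_div_iff₀ Real.pi_pos).1 (Int.floor_le _)) fun h0 =>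
        hθ (by rw [← h0, Real.sin_int_mul_pi]), ?_⟩
      exact (div_lt_iff₀ Real.pi_pos).1 (Int.lt_floor_add_one _)
    have hW_cont : Continuous W :=
      continuous_iff_continuousAt.2 fun θ => (hW.hasDerivAt θ).continuousAt
    have hX_cont : Continuous X := by fun_prop
    have hconn : OrdConnected (X '' J) :=
      (isPreconnected_Ioo.image X hX_cont.continuousOn).ordConnected
    have hzero : (0 : ℝ) ∈ X '' J := by
      refine ⟨j * Real.pi + Real.pi / 2, ⟨?_, ?_⟩, ?_⟩
      · linarith [Real.pi_pos]
      · linarith [Real.pi_pos]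
      · have : Real.cos (j * Real.pi + Real.pi / 2) = 0 := by
          rw [Real.cos_add_pi_div_two, Real.sin_int_mul_pi, neg_zero]
        simp only [hX, this, mul_zero]
    have hiter : ∀ i : ℕ, X θ / k ^ i ∈ X '' J ∧ f 0 (X θ / k ^ i) = f 0 (X θ) := by
      intro i
      induction i with
      | zero => simpa using ⟨θ, hθJ, rfl⟩
      | succ i ih =>
        have hk_pos : 0 < k := Real.exp_pos d
        have hmem : X θ / k ^ (i + 1) ∈ X '' J := by
          apply hconn.uIcc_subset hzero ih.1
          rw [pow_succ, ← div_div]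
          rcases le_total 0 (X θ / k ^ i) with h0 | h0
          · rw [uIcc_of_le h0]
            exact ⟨div_nonneg h0 hk_pos.le, div_le_self h0 hk_one.le⟩
          · rw [uIcc_of_ge h0]
            refine ⟨?_, div_nonpos_of_nonpos_of_nonneg h0 hk_pos.le⟩
            rw [le_div_iff₀ hk_pos]
            nlinarith
        refine ⟨hmem, ?_⟩
        obtain ⟨u, hu, hu_eq⟩ := hmem
        have h1 := hterm u (hJ_sin u hu) 0 (Nat.zero_le N)
        rw [hu_eq, mul_zero, pow_zero, mul_one] at h1
        rw [h1, ← ih.2]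
        congr 1
        field_simp
        ring
    obtain ⟨δ, hδ, hneg⟩ := hL1
    obtain ⟨i, hi⟩ := pow_unbounded_of_one_lt (|X θ| / δ) hk_one
    rw [← (hiter i).2]
    apply hneg
    have hki : 0 < k ^ i := pow_pos (Real.exp_pos d) i
    rw [abs_div, abs_of_pos hki, div_lt_iff₀ hki]
    rwa [div_lt_iff₀ hδ, mul_comm] at hi
  obtain ⟨θ, hθ, hnonneg⟩ := hW.exists_coeff_nonneg
  rw [dampingCoeff, Finset.sum_eq_single_of_mem 0 (by simp)] at hnonneg
  · simp only [mul_zero, pow_zero, mul_one] at hnonneg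
    exact absurd (hlowest θ hθ) (not_lt.2 hnonneg)
  · intro l hl hl0
    have h1 := hhigher θ hθ l (Nat.one_le_iff_ne_zero.2 hl0)
      (Nat.lt_succ_iff.1 (Finset.mem_range.1 hl))
    rw [h1, zero_mul]

theorem exists_polarOrbit_dampingCoeff (hf : ∀ l ≤ N, Continuous (f l))
    (hL2 : ∀ l, 1 ≤ l → l ≤ N → ∀ x : ℝ, 0 ≤ f l x)
    (hL3 : ∀ l ≤ N, MonotoneOn (f l) (Ici 0) ∧ AntitoneOn (f l) (Iic 0))
    {x y : ℝ → ℝ} {T : ℝ} (hT : 0 < T) (hx : ∀ t : ℝ, HasDerivAt x (y t) t)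
    (hy : ∀ t : ℝ, HasDerivAt y
      (-(∑ l ∈ Finset.range (N + 1), f l (x t) * y t ^ (2 * l + 1)) - x t) t)
    (hper : ∀ t : ℝ, x (t + T) = x t ∧ y (t + T) = y t)
    (hne : ∃ t₁ t₂ : ℝ, (x t₁, y t₁) ≠ (x t₂, y t₂)) :
    ∃ n Z, IsPolarOrbit (dampingCoeff N f) n Z ∧ range (fun t => (x t, y t)) =
      range fun θ => (Real.exp (Z θ) * Real.cos θ, -(Real.exp (Z θ) * Real.sin θ)) := by
  have h : IsPeriodicSolution (dampingCoeff N f) T x y :=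
    ⟨hT, hx, fun t => by rw [dampingCoeff_mul]; exact hy t, fun t => (hper t).1,
      fun t => (hper t).2⟩
  have hP := continuous_dampingCoeff hf
  obtain ⟨Q, hQ, hPQ⟩ := exists_continuous_dampingCoeff_mul_sub hf
  have hpos := h.normSq_pos hP hne
  exact h.exists_polarOrbit hP hpos
    (h.rotation_pos hP (radiallyMonotone_dampingCoeff hL2 hL3) hQ hPQ hpos)

end dampingCoeff


/-- **Uniqueness of the closed orbit.** Under hypotheses L1–L3, any two
nonconstant periodic solutions of
`x' = y`, `y' = -∑_{l=0}^N f_{2l+1}(x) y^(2l+1) - x` trace the same closed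
orbit.  Here `f l` denotes `f_{2l+1}`. -/
theorem massera_generalized_uniqueness (N : ℕ) (hN : 1 ≤ N)
    (f : ℕ → ℝ → ℝ)
    (hlip : ∀ l ≤ N, LocallyLipschitz (f l))
    (hL1 : ∃ δ > 0, ∀ x : ℝ, |x| < δ → f 0 x < 0)
    (hL2 : ∀ l, 1 ≤ l → l ≤ N → ∀ x : ℝ, 0 ≤ f l x)
    (hL3 : ∀ l ≤ N, MonotoneOn (f l) (Set.Ici 0) ∧ AntitoneOn (f l) (Set.Iic 0))
    (x₁ y₁ x₂ y₂ : ℝ → ℝ) (T₁ T₂ : ℝ) (hT₁ : 0 < T₁) (hT₂ : 0 < T₂)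
    (hx₁ : ∀ t : ℝ, HasDerivAt x₁ (y₁ t) t)
    (hy₁ : ∀ t : ℝ, HasDerivAt y₁
      (-(∑ l ∈ Finset.range (N + 1), f l (x₁ t) * y₁ t ^ (2 * l + 1)) - x₁ t) t)
    (hper₁ : ∀ t : ℝ, x₁ (t + T₁) = x₁ t ∧ y₁ (t + T₁) = y₁ t)
    (hnonconst₁ : ∃ t₁ t₂ : ℝ, (x₁ t₁, y₁ t₁) ≠ (x₁ t₂, y₁ t₂))
    (hx₂ : ∀ t : ℝ, HasDerivAt x₂ (y₂ t) t)
    (hy₂ : ∀ t : ℝ, HasDerivAt y₂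
      (-(∑ l ∈ Finset.range (N + 1), f l (x₂ t) * y₂ t ^ (2 * l + 1)) - x₂ t) t)
    (hper₂ : ∀ t : ℝ, x₂ (t + T₂) = x₂ t ∧ y₂ (t + T₂) = y₂ t)
    (hnonconst₂ : ∃ t₁ t₂ : ℝ, (x₂ t₁, y₂ t₁) ≠ (x₂ t₂, y₂ t₂)) :
    Set.range (fun t => (x₁ t, y₁ t)) = Set.range (fun t => (x₂ t, y₂ t)) := by
  have hf : ∀ l ≤ N, Continuous (f l) := fun l hl => (hlip l hl).continuous
  obtain ⟨n, Z, hZ, hZ_range⟩ :=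
    exists_polarOrbit_dampingCoeff hf hL2 hL3 hT₁ hx₁ hy₁ hper₁ hnonconst₁
  obtain ⟨m, W, hW, hW_range⟩ :=
    exists_polarOrbit_dampingCoeff hf hL2 hL3 hT₂ hx₂ hy₂ hper₂ hnonconst₂
  obtain ⟨d, hd⟩ := hZ.exists_eq_add (radiallyMonotone_dampingCoeff hL2 hL3) hW
  have hd_le := dampingCoeff_not_homothetic hL1 hL2 hL3 hZ hW hd
  have hd_ge := dampingCoeff_not_homothetic hL1 hL2 hL3 hW hZ (d := -d) fun θ => by
    rw [hd θ, add_neg_cancel_right]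
  have hZW : Z = W := funext fun θ => by rw [hd θ, show d = 0 by linarith, add_zero]
  rw [hZ_range, hW_range, hZW]
end
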